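/- Suppose $0<\beta<d$, $f\in W^{1,1}_{\mathrm{pol}}(\mathbb{S}^d)$ is nonnegative and Lipschitz, $\xi\in\mathbb{S}^d$, $\mathcal{B}=\overline{\mathcal{B}(\zeta,r)}\in\mathbf{B}_\xi^\beta$ with $r\le w(\zeta)/4$, and set $\mathcal{E}:=\{\eta\in 2\mathcal{B} : \tfrac12\fint_{\mathcal{B}}f \le f(\eta)\le 2\fint_{\mathcal{B}}f\}$. Then $\big|\fint_{\mathcal{B}}\nabla f(\eta)\cdot S(\eta)\,d\sigma(\eta)\big| \le C(d,\beta)\,\fint_{2\mathcal{B}}|\nabla f(\eta)|\,\chi_{\mathcal{E}}(\eta)\,d\sigma(\eta)$. -/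

import Mathlib

open MeasureTheory Metric Filter Topology Asymptotics
open scoped ENNReal RealInnerProductSpace NNReal

noncomputable section

/-- Euclidean space `ℝⁿ`. -/
abbrev Euc (n : ℕ) : Type := EuclideanSpace ℝ (Fin n)

/-- The unit sphere `𝕊^d ⊆ ℝ^(d+1)`. -/
abbrev Sph (d : ℕ) : Type := Metric.sphere (0 : Euc (d + 1)) 1

/-- The north pole `𝐞 = (1,0,…,0)`. -/
def npole (d : ℕ) : Sph d :=
  ⟨EuclideanSpace.single 0 1, by
    rw [mem_sphere_zero_iff_norm, EuclideanSpace.norm_single]; norm_num⟩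

/-- The south pole `-𝐞`. -/
def spole (d : ℕ) : Sph d :=
  ⟨-(npole d : Euc (d + 1)), by
    rw [mem_sphere_zero_iff_norm, norm_neg, ← mem_sphere_zero_iff_norm]
    exact (npole d).2⟩

/-- Geodesic distance on the sphere. -/
def geodist {d : ℕ} (ξ η : Sph d) : ℝ :=
  Real.arccos ⟪(ξ : Euc (d + 1)), (η : Euc (d + 1))⟫

/-- Open geodesic ball. -/
def gball {d : ℕ} (ζ : Sph d) (r : ℝ) : Set (Sph d) := {η | geodist ζ η < r}

/-- Closed geodesic ball. -/
def gcball {d : ℕ} (ζ : Sph d) (r : ℝ) : Set (Sph d) := {η | geodist ζ η ≤ r}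

/-- Geodesic sphere (boundary of a geodesic ball). -/
def gsphere {d : ℕ} (ζ : Sph d) (r : ℝ) : Set (Sph d) := {η | geodist ζ η = r}

/-- The surface measure `σ` on `𝕊^d`, as the `d`-dimensional Hausdorff measure. -/
def sphMeasure (d : ℕ) : Measure (Sph d) :=
  Measure.comap Subtype.val (MeasureTheory.Measure.hausdorffMeasure (d : ℝ))

/-- The `(d-1)`-dimensional Hausdorff measure on `𝕊^d` (surface measure of boundaries of
geodesic balls). -/
def sphBdry (d : ℕ) : Measure (Sph d) :=
  Measure.comap Subtype.val (MeasureTheory.Measure.hausdorffMeasure ((d : ℝ) - 1))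

/-- Polar angle `θ(ξ) = d(𝐞, ξ)`. -/
def polarAngle {d : ℕ} (ξ : Sph d) : ℝ := geodist (npole d) ξ

/-- `w(ξ) = min{θ(ξ), π - θ(ξ)}`. -/
def sphWidth {d : ℕ} (ξ : Sph d) : ℝ := min (polarAngle ξ) (Real.pi - polarAngle ξ)

/-- A function on the sphere is polar if it only depends on `ξ ⬝ 𝐞`. -/
def IsPolar {d : ℕ} (f : Sph d → ℝ) : Prop :=
  ∀ ξ η : Sph d,
    ⟪(ξ : Euc (d + 1)), (npole d : Euc (d + 1))⟫ =
      ⟪(η : Euc (d + 1)), (npole d : Euc (d + 1))⟫ → f ξ = f η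

/-- The uncentered fractional Hardy–Littlewood maximal function `𝓜̃_β f` on `𝕊^d`. -/
def sphMax {d : ℕ} (β : ℝ) (f : Sph d → ℝ) (ξ : Sph d) : ℝ :=
  sSup {a | ∃ ζ : Sph d, ∃ r : ℝ, 0 < r ∧ r ≤ Real.pi ∧ geodist ζ ξ ≤ r ∧
    a = r ^ β * ⨍ η in gball ζ r, |f η| ∂(sphMeasure d)}

/-- The closed ball `B̄(ζ,r)` is a best ball for `𝓜̃_β f` at `ξ`, i.e. it contains `ξ` and
realizes the supremum defining `𝓜̃_β f (ξ)`. -/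
def IsBestBall {d : ℕ} (β : ℝ) (f : Sph d → ℝ) (ξ ζ : Sph d) (r : ℝ) : Prop :=
  0 ≤ r ∧ r ≤ Real.pi ∧ geodist ζ ξ ≤ r ∧
    sphMax β f ξ = r ^ β * ⨍ η in gball ζ r, |f η| ∂(sphMeasure d)

/-- Projection onto the tangent space of the sphere at `η`. -/
def tangProj {d : ℕ} (η : Sph d) (v : Euc (d + 1)) : Euc (d + 1) :=
  v - ⟪v, (η : Euc (d + 1))⟫ • (η : Euc (d + 1))

/-- `g` is the weak (tangential) gradient of `f` on `𝕊^d`: `g` is a.e. tangent and the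
integration-by-parts formula against restrictions of smooth test functions holds. -/
def HasWeakGrad {d : ℕ} (f : Sph d → ℝ) (g : Sph d → Euc (d + 1)) : Prop :=
  (∀ᵐ η ∂(sphMeasure d), ⟪g η, (η : Euc (d + 1))⟫ = 0) ∧
  ∀ φ : Euc (d + 1) → ℝ, ContDiff ℝ (⊤ : ℕ∞) φ →
    ∫ η, φ (η : Euc (d + 1)) • g η ∂(sphMeasure d)
      = - ∫ η, f η • tangProj η (gradient φ (η : Euc (d + 1))) ∂(sphMeasure d)
        + (d : ℝ) • ∫ η, (f η * φ (η : Euc (d + 1))) • (η : Euc (d + 1)) ∂(sphMeasure d)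

/-- `f ∈ W^{1,1}(𝕊^d)`, with weak gradient `g`. -/
def MemW11 {d : ℕ} (f : Sph d → ℝ) (g : Sph d → Euc (d + 1)) : Prop :=
  Integrable f (sphMeasure d) ∧ Integrable g (sphMeasure d) ∧ HasWeakGrad f g

/-- Convergence `f_j → f` in `W^{1,1}(𝕊^d)` (with weak gradients `g_j, g`). -/
def W11Tendsto {d : ℕ} (fj : ℕ → Sph d → ℝ) (gj : ℕ → Sph d → Euc (d + 1))
    (f : Sph d → ℝ) (g : Sph d → Euc (d + 1)) : Prop :=
  Tendsto (fun j => (∫ ξ, |fj j ξ - f ξ| ∂(sphMeasure d)) +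
    ∫ ξ, ‖gj j ξ - g ξ‖ ∂(sphMeasure d)) atTop (nhds 0)

/-- `u : 𝕊^d → ℝ` is differentiable at `ξ` with (tangential) gradient `G`. -/
def HasSphereGradAt {d : ℕ} (u : Sph d → ℝ) (G : Euc (d + 1)) (ξ : Sph d) : Prop :=
  ⟪G, (ξ : Euc (d + 1))⟫ = 0 ∧
    (fun η : Sph d => u η - u ξ - ⟪G, (η : Euc (d + 1)) - (ξ : Euc (d + 1))⟫)
      =o[nhds ξ] (fun η : Sph d => dist η ξ)

/-- The unit tangent vector at `η` pointing in the direction of the geodesic from `η` to `ζ`: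
`v(η,ζ) = (ζ - (η·ζ)η)/|ζ - (η·ζ)η|`. -/
def gdir {d : ℕ} (η ζ : Sph d) : Euc (d + 1) :=
  ‖(ζ : Euc (d + 1)) - ⟪(η : Euc (d + 1)), (ζ : Euc (d + 1))⟫ • (η : Euc (d + 1))‖⁻¹ •
    ((ζ : Euc (d + 1)) - ⟪(η : Euc (d + 1)), (ζ : Euc (d + 1))⟫ • (η : Euc (d + 1)))

/-- `S(η) = (η·v(ξ,𝐞))ξ - (η·ξ)v(ξ,𝐞)`. -/
def Svec {d : ℕ} (ξ η : Sph d) : Euc (d + 1) :=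
  ⟪(η : Euc (d + 1)), gdir ξ (npole d)⟫ • (ξ : Euc (d + 1)) -
    ⟪(η : Euc (d + 1)), (ξ : Euc (d + 1))⟫ • gdir ξ (npole d)

/-- `ζ` lies on the (closed) half great circle determined by `𝐞`, `ξ` and `-𝐞`
(the one passing through `ξ`). -/
def OnHalfGreatCircle {d : ℕ} (ξ ζ : Sph d) : Prop :=
  ∃ a b : ℝ, 0 ≤ b ∧ (ζ : Euc (d + 1)) = a • (npole d : Euc (d + 1)) +
    b • ((ξ : Euc (d + 1)) -
      ⟪(ξ : Euc (d + 1)), (npole d : Euc (d + 1))⟫ • (npole d : Euc (d + 1)))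

/-- `σ(r)` up to the constant `κ_{d-1}`: `∫₀^r (sin t)^{d-1} dt`. -/
def sinInt (d : ℕ) (r : ℝ) : ℝ := ∫ t in (0:ℝ)..r, (Real.sin t) ^ (d - 1)

/-- `σ'(r)` up to the constant `κ_{d-1}`: `(sin r)^{d-1}`. -/
def sinPow (d : ℕ) (r : ℝ) : ℝ := (Real.sin r) ^ (d - 1)

lemma sphMeasure_eq (d : ℕ) :
    sphMeasure d = MeasureTheory.Measure.hausdorffMeasure (X := Sph d) (d : ℝ) := by
  ext s hs
  have hm : MeasurableEmbedding (Subtype.val : Sph d → Euc (d+1)) :=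
    MeasurableEmbedding.subtype_coe (Metric.isClosed_sphere.measurableSet)
  rw [sphMeasure, hm.comap_apply]
  exact isometry_subtype_coe.hausdorffMeasure_image (Or.inl (by positivity)) s

lemma sph_norm {d : ℕ} (η : Sph d) : ‖(η : Euc (d+1))‖ = 1 := by
  simpa using η.2

lemma sph_inner_self {d : ℕ} (η : Sph d) : ⟪(η : Euc (d+1)), (η : Euc (d+1))⟫ = 1 := by
  rw [real_inner_self_eq_norm_sq, sph_norm]; norm_num

lemma sph_inner_le {d : ℕ} (η ζ : Sph d) : ⟪(η : Euc (d+1)), (ζ : Euc (d+1))⟫ ≤ 1 := by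
  have := real_inner_le_norm (η : Euc (d+1)) (ζ : Euc (d+1))
  rw [sph_norm, sph_norm] at this; linarith

lemma sph_inner_ge {d : ℕ} (η ζ : Sph d) : -1 ≤ ⟪(η : Euc (d+1)), (ζ : Euc (d+1))⟫ := by
  have := abs_real_inner_le_norm (η : Euc (d+1)) (ζ : Euc (d+1))
  rw [sph_norm, sph_norm] at this; linarith [(abs_le.1 this).1]

lemma mem_gball_iff {d : ℕ} {ζ η : Sph d} {r : ℝ} (h0 : 0 ≤ r) (h1 : r ≤ Real.pi) :
    η ∈ gball ζ r ↔ Real.cos r < ⟪(ζ : Euc (d+1)), (η : Euc (d+1))⟫ := by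
  unfold gball geodist
  simp only [Set.mem_ofPred_eq]
  conv_rhs => rw [← Real.cos_arccos (sph_inner_ge ζ η) (sph_inner_le ζ η)]
  exact (Real.strictAntiOn_cos.lt_iff_gt ⟨h0, h1⟩
    ⟨Real.arccos_nonneg _, Real.arccos_le_pi _⟩).symm

lemma continuous_geodist {d : ℕ} (ζ : Sph d) : Continuous (fun η : Sph d => geodist ζ η) := by
  unfold geodist
  fun_prop

lemma isOpen_gball {d : ℕ} (ζ : Sph d) (r : ℝ) : IsOpen (gball ζ r) :=
  isOpen_lt (continuous_geodist ζ) continuous_const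

lemma measurableSet_gball {d : ℕ} (ζ : Sph d) (r : ℝ) : MeasurableSet (gball ζ r) :=
  (isOpen_gball ζ r).measurableSet

abbrev Perp {d : ℕ} (ζ : Sph d) : Submodule ℝ (Euc (d+1)) := (Submodule.span ℝ {(ζ : Euc (d+1))})ᗮ

/-- Projection onto the hyperplane orthogonal to `ζ`. -/
def Qproj {d : ℕ} (ζ η : Sph d) : Perp ζ :=
  ⟨(η : Euc (d+1)) - ⟪(ζ : Euc (d+1)), (η : Euc (d+1))⟫ • (ζ : Euc (d+1)), by
    rw [Submodule.mem_orthogonal_singleton_iff_inner_right, inner_sub_right, inner_smul_right,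
      sph_inner_self]; ring⟩

lemma Qproj_norm_sq {d : ℕ} (ζ η : Sph d) :
    ‖Qproj ζ η‖^2 = 1 - ⟪(ζ : Euc (d+1)), (η : Euc (d+1))⟫^2 := by
  rw [← Submodule.norm_coe, Qproj, ← real_inner_self_eq_norm_sq]
  simp only [inner_sub_right, inner_sub_left, inner_smul_left, inner_smul_right, sph_inner_self,
    real_inner_comm (ζ : Euc (d+1)) (η : Euc (d+1))]
  simp
  ring

lemma Qproj_dist_sq {d : ℕ} (ζ η η' : Sph d) :
    dist η η' ^2 = dist (Qproj ζ η) (Qproj ζ η') ^2 +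
     (⟪(ζ : Euc (d+1)), (η : Euc (d+1))⟫ - ⟪(ζ : Euc (d+1)), (η' : Euc (d+1))⟫)^2 := by
  rw [Subtype.dist_eq, Subtype.dist_eq, dist_eq_norm, dist_eq_norm, Qproj, Qproj]
  simp only
  rw [← real_inner_self_eq_norm_sq, ← real_inner_self_eq_norm_sq]
  simp only [inner_sub_right, inner_sub_left, inner_smul_left, inner_smul_right, sph_inner_self,
    real_inner_comm (ζ : Euc (d+1)) (η : Euc (d+1)), real_inner_comm (ζ : Euc (d+1)) (η' : Euc (d+1)), real_inner_comm (η : Euc (d+1)) (η' : Euc (d+1))]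
  simp
  ring

lemma Qproj_dist_le {d : ℕ} (ζ η η' : Sph d) : dist (Qproj ζ η) (Qproj ζ η') ≤ dist η η' := by
  have := Qproj_dist_sq ζ η η'
  refine le_of_sq_le_sq ?_ dist_nonneg
  nlinarith [sq_nonneg (⟪(ζ : Euc (d+1)), (η : Euc (d+1))⟫ - ⟪(ζ : Euc (d+1)), (η' : Euc (d+1))⟫)]

lemma Qproj_anti {d : ℕ} (ζ η η' : Sph d) (h : 1/2 ≤ ⟪(ζ : Euc (d+1)), (η : Euc (d+1))⟫)
    (h' : 1/2 ≤ ⟪(ζ : Euc (d+1)), (η' : Euc (d+1))⟫) :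
    dist η η' ≤ 3 * dist (Qproj ζ η) (Qproj ζ η') := by
  have h1 := Qproj_dist_sq ζ η η'
  have h2 := Qproj_norm_sq ζ η
  have h3 := Qproj_norm_sq ζ η'
  have h4 := abs_norm_sub_norm_le (Qproj ζ η) (Qproj ζ η')
  rw [← dist_eq_norm] at h4
  set a := ⟪(ζ : Euc (d+1)), (η : Euc (d+1))⟫
  set b := ⟪(ζ : Euc (d+1)), (η' : Euc (d+1))⟫
  have hp := norm_nonneg (Qproj ζ η)
  have hq := norm_nonneg (Qproj ζ η')
  set p := ‖Qproj ζ η‖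
  set q := ‖Qproj ζ η'‖
  have hD : 0 ≤ dist (Qproj ζ η) (Qproj ζ η') := dist_nonneg
  set D := dist (Qproj ζ η) (Qproj ζ η')
  have hp1 : p ≤ 1 := by nlinarith
  have hq1 : q ≤ 1 := by nlinarith
  have key : |a - b| ≤ 2 * D := by
    have e : |a-b| * (a+b) = |p - q| * (p+q) := by
      rw [← abs_of_nonneg (show 0 ≤ a + b by linarith), ← abs_of_nonneg (show 0 ≤ p + q by linarith),
        ← abs_mul, ← abs_mul, ← abs_neg]
      congr 1; nlinarith
    have : |a-b| * 1 ≤ |a-b| * (a+b) := by gcongr; linarith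
    have : |p-q| * (p+q) ≤ D * 2 := by gcongr; linarith
    linarith
  have : (a-b)^2 ≤ (2*D)^2 := sq_le_sq' (by linarith [(abs_le.1 key).1]) (abs_le.1 key).2
  refine le_of_sq_le_sq ?_ (by positivity)
  nlinarith

lemma finrank_Perp {d : ℕ} (ζ : Sph d) : Module.finrank ℝ (Perp ζ) = d := by
  have : Fact (Module.finrank ℝ (Euc (d+1)) = d + 1) := ⟨by simp⟩
  exact Submodule.finrank_orthogonal_span_singleton (by
    intro h; have := sph_norm ζ; rw [h] at this; simp at this)

/-- Hausdorff measure of the unit ball of the hyperplane. -/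
def cPerp {d : ℕ} (ζ : Sph d) : ℝ≥0∞ :=
  MeasureTheory.Measure.hausdorffMeasure (X := Perp ζ) (d : ℝ) (ball 0 1)

instance perpHaar {d : ℕ} (ζ : Sph d) :
    (MeasureTheory.Measure.hausdorffMeasure (X := Perp ζ) (d : ℝ)).IsAddHaarMeasure := by
  have := MeasureTheory.isAddHaarMeasure_hausdorffMeasure (E := Perp ζ)
  rwa [finrank_Perp] at this

lemma cPerp_pos {d : ℕ} (ζ : Sph d) : cPerp ζ ≠ 0 := (measure_ball_pos _ _ one_pos).ne'
lemma cPerp_top {d : ℕ} (ζ : Sph d) : cPerp ζ ≠ ∞ := measure_ball_lt_top.ne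

lemma perp_ball {d : ℕ} (hd : 1 ≤ d) (ζ : Sph d) {r : ℝ} (hr : 0 ≤ r) :
    MeasureTheory.Measure.hausdorffMeasure (X := Perp ζ) (d : ℝ) (ball 0 r)
      = ENNReal.ofReal (r ^ d) * cPerp ζ := by
  have : Nontrivial (Perp ζ) := Module.nontrivial_of_finrank_pos (R := ℝ) (by rw [finrank_Perp]; omega)
  have := Measure.addHaar_ball (MeasureTheory.Measure.hausdorffMeasure (X := Perp ζ) (d : ℝ)) 0 hr
  rwa [finrank_Perp] at this

lemma gball_lower {d : ℕ} (hd : 1 ≤ d) (ζ : Sph d) {r : ℝ} (hr : 0 ≤ r) (hr2 : r ≤ Real.pi/2) :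
    ENNReal.ofReal (Real.sin r ^ d) * cPerp ζ ≤ sphMeasure d (gball ζ r) := by
  have hpi := Real.pi_pos
  have hs : 0 ≤ Real.sin r := Real.sin_nonneg_of_nonneg_of_le_pi hr (by linarith)
  have hc : 0 ≤ Real.cos r := Real.cos_nonneg_of_mem_Icc ⟨by linarith, hr2⟩
  rw [← perp_ball hd ζ hs, sphMeasure_eq]
  have hL : LipschitzWith 1 (Qproj ζ) := LipschitzWith.of_dist_le_mul (by
    intro x y; simpa using Qproj_dist_le ζ x y)
  have h1 := hL.hausdorffMeasure_image_le (d := (d:ℝ)) (by positivity) (gball ζ r)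
  simp only [ENNReal.coe_one, ENNReal.one_rpow, one_mul] at h1
  refine le_trans (measure_mono ?_) h1
  intro x hx
  rw [mem_ball_zero_iff] at hx
  have hx2 : ‖x‖^2 < Real.sin r ^2 := by gcongr
  have hsc := Real.sin_sq_add_cos_sq r
  have hpos : 0 ≤ 1 - ‖x‖^2 := by nlinarith
  have hxζ : ⟪(ζ : Euc (d+1)), (x : Euc (d+1))⟫ = 0 :=
    (Submodule.mem_orthogonal_singleton_iff_inner_right).1 x.2
  have hxζ' : ⟪(x : Euc (d+1)), (ζ : Euc (d+1))⟫ = 0 := by rw [real_inner_comm]; exact hxζ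
  set c := Real.sqrt (1 - ‖x‖^2) with hcdef
  have hc2 : c ^2 = 1 - ‖x‖^2 := Real.sq_sqrt hpos
  let η : Sph d := ⟨(x : Euc (d+1)) + c • (ζ : Euc (d+1)), by
    rw [mem_sphere_zero_iff_norm]
    have : ‖(x : Euc (d+1)) + c • (ζ : Euc (d+1))‖^2 = 1 := by
      rw [← real_inner_self_eq_norm_sq]
      simp only [inner_add_right, inner_add_left, inner_smul_left, inner_smul_right,
        sph_inner_self, hxζ, hxζ', real_inner_self_eq_norm_sq]
      rw [← Submodule.norm_coe] at hc2
      simp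
      nlinarith [hc2, sph_norm ζ]
    have h0 := norm_nonneg ((x : Euc (d+1)) + c • (ζ : Euc (d+1)))
    nlinarith⟩
  have hin : ⟪(ζ : Euc (d+1)), (η : Euc (d+1))⟫ = c := by
    simp only [η, inner_add_right, inner_smul_right, sph_inner_self, hxζ]; ring
  refine ⟨η, ?_, ?_⟩
  · rw [mem_gball_iff hr (by linarith), hin]
    apply Real.lt_sqrt_of_sq_lt
    nlinarith
  · ext1
    simp only [Qproj, hin]
    simp [η]

lemma annulus_upper {d : ℕ} (hd : 1 ≤ d) (ζ : Sph d) {r s : ℝ} (hr : 0 ≤ r) (hrs : r ≤ s)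
    (hs : s ≤ Real.pi/3) :
    sphMeasure d (gball ζ s \ gball ζ r) ≤
      3 ^ d * (ENNReal.ofReal (Real.sin s ^ d - Real.sin r ^ d) * cPerp ζ) := by
  have hpi := Real.pi_pos
  have hs0 : 0 ≤ Real.sin r := Real.sin_nonneg_of_nonneg_of_le_pi hr (by linarith)
  have hs1 : 0 ≤ Real.sin s := Real.sin_nonneg_of_nonneg_of_le_pi (by linarith) (by linarith)
  have hsin : Real.sin r ≤ Real.sin s :=
    Real.sin_le_sin_of_le_of_le_pi_div_two (by linarith) (by linarith) hrs
  rw [sphMeasure_eq]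
  set T := gball ζ s \ gball ζ r with hT
  have hhalf : ∀ η ∈ T, 1/2 ≤ ⟪(ζ : Euc (d+1)), (η : Euc (d+1))⟫ := by
    intro η hη
    have := (mem_gball_iff (by linarith) (by linarith)).1 hη.1
    have h3 : Real.cos (Real.pi/3) ≤ Real.cos s :=
      Real.cos_le_cos_of_nonneg_of_le_pi (by linarith) (by linarith) hs
    rw [Real.cos_pi_div_three] at h3
    linarith
  have hA : AntilipschitzWith 3 (fun x : T => Qproj ζ x) := AntilipschitzWith.of_le_mul_dist (by
    intro x y
    exact Qproj_anti ζ x y (hhalf x x.2) (hhalf y y.2))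
  have h1 := hA.le_hausdorffMeasure_image (d := (d:ℝ)) (by positivity) Set.univ
  have h2 : Measure.hausdorffMeasure (X := Sph d) (d:ℝ) T
      = Measure.hausdorffMeasure (X := T) (d:ℝ) Set.univ := by
    have := (isometry_subtype_coe (s := T)).hausdorffMeasure_image (d := (d:ℝ))
      (Or.inl (by positivity)) Set.univ
    rw [← this]; simp
  rw [h2]
  refine h1.trans ?_
  rw [ENNReal.rpow_natCast]
  refine mul_le_mul' (by simp) ?_
  have hsub : (fun x : T => Qproj ζ x) '' Set.univ ⊆ ball 0 (Real.sin s) \ ball 0 (Real.sin r) := by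
    rintro _ ⟨⟨η, hη⟩, -, rfl⟩
    have e := Qproj_norm_sq ζ η
    have ha := hhalf η hη
    have h1 := (mem_gball_iff (by linarith) (by linarith)).1 hη.1
    have h2 := mt (mem_gball_iff hr (by linarith)).2 hη.2
    have hcs : 0 ≤ Real.cos s := Real.cos_nonneg_of_mem_Icc ⟨by linarith, by linarith⟩
    have := Real.sin_sq_add_cos_sq s
    have := Real.sin_sq_add_cos_sq r
    have := norm_nonneg (Qproj ζ η)
    simp only [Set.mem_sdiff, mem_ball_zero_iff, not_lt]
    constructor
    · refine lt_of_pow_lt_pow_left₀ 2 hs1 ?_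
      nlinarith
    · refine le_of_sq_le_sq ?_ this
      nlinarith
  refine (measure_mono hsub).trans ?_
  rw [measure_sdiff (ball_subset_ball hsin) measurableSet_ball.nullMeasurableSet measure_ball_lt_top.ne,
    perp_ball hd ζ hs0, perp_ball hd ζ hs1, ENNReal.ofReal_sub _ (by positivity),
    ENNReal.sub_mul (fun _ _ => cPerp_top ζ)]

lemma gball_zero {d : ℕ} (ζ : Sph d) {r : ℝ} (hr : r ≤ 0) : gball ζ r = ∅ := by
  ext η
  simp only [gball, geodist, Set.mem_ofPred_eq, Set.mem_empty_iff_false, iff_false, not_lt]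
  exact hr.trans (Real.arccos_nonneg _)

lemma geodist_self {d : ℕ} (ζ : Sph d) : geodist ζ ζ = 0 := by
  rw [geodist, sph_inner_self, Real.arccos_one]

lemma sphMeasure_finite {d : ℕ} (hd : 1 ≤ d) : IsFiniteMeasure (sphMeasure d) := by
  have : IsLocallyFiniteMeasure (sphMeasure d) := ⟨fun ζ => by
    have hpi := Real.pi_pos
    refine ⟨gball ζ (Real.pi/3), (isOpen_gball _ _).mem_nhds ?_, ?_⟩
    · simp only [gball, Set.mem_ofPred_eq, geodist_self]; positivity
    · have := annulus_upper hd ζ (r := 0) (s := Real.pi/3) le_rfl (by positivity) le_rfl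
      rw [gball_zero ζ le_rfl, Set.sdiff_empty] at this
      refine this.trans_lt ?_
      exact ENNReal.mul_lt_top (by simp) (ENNReal.mul_lt_top ENNReal.ofReal_lt_top (cPerp_top ζ).lt_top)⟩
  infer_instance

lemma gball_mono {d : ℕ} (ζ : Sph d) {r s : ℝ} (h : r ≤ s) : gball ζ r ⊆ gball ζ s :=
  fun _ hη => lt_of_lt_of_le hη h

lemma gball_pos {d : ℕ} (hd : 1 ≤ d) (ζ : Sph d) {r : ℝ} (hr : 0 < r) :
    0 < (sphMeasure d).real (gball ζ r) := by
  have := sphMeasure_finite hd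
  have hpi := Real.pi_pos
  have h1 := gball_lower hd ζ (r := min r (Real.pi/2)) (by positivity) (min_le_right _ _)
  have h2 : 0 < Real.sin (min r (Real.pi/2)) :=
    Real.sin_pos_of_pos_of_lt_pi (by positivity) (lt_of_le_of_lt (min_le_right _ _) (by linarith))
  rw [measureReal_def]
  refine ENNReal.toReal_pos ?_ (measure_ne_top _ _)
  have h3 := measure_mono (μ := sphMeasure d) (gball_mono ζ (min_le_left r (Real.pi/2)))
  refine (lt_of_lt_of_le ?_ (h1.trans h3)).ne'
  exact ENNReal.mul_pos (by simpa using by positivity) (cPerp_pos ζ)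

/-- The constant in the annulus estimate. -/
def C0 (d : ℕ) : ℝ := 12 ^ d * d

lemma pow_sub_le {d : ℕ} {a b M : ℝ} (hb : 0 ≤ b) (hab : b ≤ a) (haM : a ≤ M) :
    a ^ d - b ^ d ≤ d * (a - b) * M ^ (d-1) := by
  have h := Commute.geom_sum₂_mul (Commute.all a b) d
  rw [← h]
  have : ∑ i ∈ Finset.range d, a ^ i * b ^ (d - 1 - i) ≤ ∑ i ∈ Finset.range d, M ^ (d-1) := by
    apply Finset.sum_le_sum
    intro i hi
    have hi' := Finset.mem_range.1 hi
    have : M ^ (d-1) = M ^ i * M ^ (d-1-i) := by rw [← pow_add]; congr 1; omega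
    rw [this]
    have : 0 ≤ a := by linarith
    have : 0 ≤ M := by linarith
    have : b ≤ M := by linarith
    gcongr
  rw [Finset.sum_const, Finset.card_range, nsmul_eq_mul] at this
  have := mul_le_mul_of_nonneg_right this (sub_nonneg.2 hab)
  linarith

lemma annulus_le {d : ℕ} (hd : 1 ≤ d) (ζ : Sph d) {r s : ℝ} (hr : 0 < r) (hr8 : r ≤ Real.pi / 8)
    (hrs : r ≤ s) (hs : s ≤ 2 * r) :
    (sphMeasure d).real (gball ζ s \ gball ζ r) ≤
      C0 d * ((s - r) / r) * (sphMeasure d).real (gball ζ r) := by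
  have := sphMeasure_finite hd
  have hpi := Real.pi_pos
  have h1 := gball_lower hd ζ hr.le (by linarith)
  have h2 := annulus_upper hd ζ hr.le hrs (by linarith)
  have hs0 : 0 ≤ Real.sin r := Real.sin_nonneg_of_nonneg_of_le_pi hr.le (by linarith)
  have hsin : Real.sin r ≤ Real.sin s :=
    Real.sin_le_sin_of_le_of_le_pi_div_two (by linarith) (by linarith) hrs
  have h1' := ENNReal.toReal_mono (measure_ne_top _ _) h1
  have h2' := ENNReal.toReal_mono (by
    exact ENNReal.mul_ne_top (by simp) (ENNReal.mul_ne_top ENNReal.ofReal_ne_top (cPerp_top ζ))) h2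
  rw [ENNReal.toReal_mul, ENNReal.toReal_ofReal (by positivity)] at h1'
  rw [ENNReal.toReal_mul, ENNReal.toReal_mul, ENNReal.toReal_ofReal (by
    rw [sub_nonneg]; gcongr)] at h2'
  simp only [ENNReal.toReal_pow, ENNReal.toReal_ofNat] at h2'
  rw [← measureReal_def] at h1' h2'
  set c := (cPerp ζ).toReal
  have hc : 0 ≤ c := ENNReal.toReal_nonneg
  have hsr : r / 2 ≤ Real.sin r := by
    have := Real.mul_le_sin hr.le (by linarith)
    have h4 : 1/2 ≤ 2 / Real.pi := by
      rw [div_le_div_iff₀ (by norm_num) hpi]; linarith [Real.pi_le_four]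
    nlinarith
  have hss : Real.sin s ≤ 2 * r := (Real.sin_le (by linarith)).trans hs
  have hdif : Real.sin s - Real.sin r ≤ s - r := by
    have := Real.abs_sin_sub_sin_le s r
    rw [abs_of_nonneg (by linarith : 0 ≤ s - r)] at this
    exact (le_abs_self _).trans this
  have h5 := pow_sub_le (d := d) hs0 hsin hss
  have h6 : Real.sin s ^ d - Real.sin r ^ d ≤ d * (s - r) * (2 * r)^(d-1) := by
    refine h5.trans ?_; gcongr
  calc _ ≤ 3 ^ d * ((d * (s - r) * (2 * r)^(d-1)) * c) := by
        refine h2'.trans ?_; gcongr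
    _ ≤ 3 ^ d * ((d * (s - r) * ((2 * r)^(d-1) * 2)) * c) := by
        have : (2 * r)^(d-1) ≤ (2 * r)^(d-1) * 2 := by
          have : 0 ≤ (2 * r)^(d-1) := by positivity
          linarith
        have : 0 ≤ s - r := by linarith
        gcongr
    _ = C0 d * ((s - r) / r) * ((r/2)^d * c) := by
        obtain ⟨k, rfl⟩ : ∃ k, d = k + 1 := ⟨d-1, by omega⟩
        have h12 : (12 : ℝ) ^ (k+1) = 3 ^ (k+1) * 2 ^ (k+1) * 2 ^(k+1) := by
          rw [← mul_pow, ← mul_pow]; norm_num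
        simp only [C0, Nat.add_sub_cancel, h12, div_pow, mul_pow]
        field_simp
        ring
    _ ≤ C0 d * ((s - r) / r) * (Real.sin r ^ d * c) := by
        have : 0 ≤ s - r := by linarith
        have : 0 ≤ C0 d := by unfold C0; positivity
        gcongr
    _ ≤ _ := by
        have : 0 ≤ s - r := by linarith
        have : 0 ≤ C0 d := by unfold C0; positivity
        gcongr

lemma C0_pos {d : ℕ} (hd : 1 ≤ d) : 0 < C0 d := by
  unfold C0
  have : (0:ℝ) < d := by exact_mod_cast hd
  positivity

lemma doubling {d : ℕ} (hd : 1 ≤ d) (ζ : Sph d) {r : ℝ} (hr : 0 < r) (hr8 : r ≤ Real.pi / 8) :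
    (sphMeasure d).real (gball ζ (2 * r)) ≤ (1 + C0 d) * (sphMeasure d).real (gball ζ r) := by
  have := sphMeasure_finite hd
  have h := annulus_le hd ζ hr hr8 (s := 2 * r) (by linarith) le_rfl
  rw [measureReal_sdiff (gball_mono ζ (by linarith)) (measurableSet_gball _ _)] at h
  have : (2 * r - r) / r = 1 := by field_simp; ring
  rw [this] at h
  linarith

lemma integral_rot {d : ℕ} (R : Euc (d+1) ≃ₗᵢ[ℝ] Euc (d+1)) :
    ∃ T : Sph d ≃ᵢ Sph d, (∀ η, (T η : Euc (d+1)) = R η) ∧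
      MeasurePreserving T (sphMeasure d) (sphMeasure d) := by
  let T : Sph d ≃ᵢ Sph d :=
    { toFun := fun η => ⟨R η, by simp⟩
      invFun := fun η => ⟨R.symm η, by simp⟩
      left_inv := fun η => by ext1; simp
      right_inv := fun η => by ext1; simp
      isometry_toFun := by
        refine Isometry.of_dist_eq fun x y => ?_
        rw [Subtype.dist_eq, Subtype.dist_eq]
        simp }
  refine ⟨T, fun η => rfl, ?_⟩
  rw [sphMeasure_eq]
  exact T.measurePreserving_hausdorffMeasure _

/-- The antisymmetric linear vector field `x ↦ (x·v)u - (x·u)v`. -/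
def Sk {d : ℕ} (u v x : Euc (d+1)) : Euc (d+1) := ⟪x, v⟫ • u - ⟪x, u⟫ • v

lemma Svec_eq {d : ℕ} (ξ η : Sph d) : Svec ξ η = Sk (ξ : Euc (d+1)) (gdir ξ (npole d)) η := rfl

lemma Sk_norm_le {d : ℕ} {u v : Euc (d+1)} (hu : ‖u‖ ≤ 1) (hv : ‖v‖ ≤ 1) (x : Euc (d+1)) :
    ‖Sk u v x‖ ≤ 2 * ‖x‖ := by
  unfold Sk
  refine (norm_sub_le _ _).trans ?_
  rw [norm_smul, norm_smul]
  have h1 : ‖⟪x, v⟫‖ ≤ ‖x‖ * 1 := (norm_inner_le_norm x v).trans (by gcongr)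
  have h2 : ‖⟪x, u⟫‖ ≤ ‖x‖ * 1 := (norm_inner_le_norm x u).trans (by gcongr)
  have h3 : ‖⟪x, v⟫‖ * ‖u‖ ≤ (‖x‖ * 1) * 1 := by gcongr
  have h4 : ‖⟪x, u⟫‖ * ‖v‖ ≤ (‖x‖ * 1) * 1 := by gcongr
  linarith

lemma continuous_Sk {d : ℕ} (u v : Euc (d+1)) : Continuous (Sk u v) := by
  unfold Sk; fun_prop

lemma Sk_inner_le {d : ℕ} {u v : Euc (d+1)} (hu : ‖u‖ ≤ 1) (hv : ‖v‖ ≤ 1) (x y : Euc (d+1))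
    (hy : ‖y‖ ≤ 1) :
    |⟪y, Sk u v x⟫| ≤ 2 * ‖x - y‖ := by
  have : ⟪y, Sk u v x⟫ = ⟪y, Sk u v (x - y)⟫ := by
    simp only [Sk, inner_sub_left, inner_sub_right, inner_smul_right]
    ring
  rw [this]
  refine (abs_real_inner_le_norm _ _).trans ?_
  have := Sk_norm_le hu hv (x - y)
  have h0 := norm_nonneg (Sk u v (x-y))
  nlinarith

lemma cont_integrable {d : ℕ} (hd : 1 ≤ d) {F : Type*} [NormedAddCommGroup F]
    {h : Sph d → F} (hh : Continuous h) : Integrable h (sphMeasure d) := by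
  have := sphMeasure_finite hd
  exact hh.integrable_of_hasCompactSupport (HasCompactSupport.of_compactSpace _)

lemma continuous_gradient {d : ℕ} {φ : Euc (d+1) → ℝ} (hφ : ContDiff ℝ (⊤ : ℕ∞) φ) :
    Continuous (gradient φ) := by
  unfold gradient
  exact (LinearIsometryEquiv.continuous _).comp (hφ.continuous_fderiv (by simp))

lemma contmul_integrable {d : ℕ} (hd : 1 ≤ d) {k : Sph d → ℝ} (hk : Integrable k (sphMeasure d))
    {h : Sph d → ℝ} (hh : Continuous h) : Integrable (fun η => h η * k η) (sphMeasure d) := by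
  obtain ⟨C, hC⟩ := (isCompact_univ (X := Sph d)).exists_bound_of_continuousOn hh.continuousOn
  exact hk.bdd_mul hh.aestronglyMeasurable (Eventually.of_forall fun x => hC x (Set.mem_univ _))

lemma weak_inner {d : ℕ} (hd : 1 ≤ d) {f : Sph d → ℝ} {g : Sph d → Euc (d+1)} (hfg : MemW11 f g)
    (hf : Continuous f) {φ : Euc (d+1) → ℝ} (hφ : ContDiff ℝ (⊤ : ℕ∞) φ) (u : Euc (d+1)) :
    ∫ η, φ (η : Euc (d+1)) * ⟪u, g η⟫ ∂(sphMeasure d) =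
      - ∫ η, f η * ⟪u, tangProj η (gradient φ (η : Euc (d+1)))⟫ ∂(sphMeasure d)
      + d * ∫ η, (f η * φ (η : Euc (d+1))) * ⟪u, (η : Euc (d+1))⟫ ∂(sphMeasure d) := by
  have hφc : Continuous (fun η : Sph d => φ η) := hφ.continuous.comp continuous_subtype_val
  have hgc : Continuous (fun η : Sph d => gradient φ (η : Euc (d+1))) :=
    (continuous_gradient hφ).comp continuous_subtype_val
  have h := congrArg (fun z => ⟪u, z⟫) (hfg.2.2.2 φ hφ)
  simp only [inner_add_right, inner_neg_right, inner_smul_right] at h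
  have i1 : Integrable (fun η : Sph d => φ (η : Euc (d+1)) • g η) (sphMeasure d) := by
    obtain ⟨C, hC⟩ := (isCompact_univ (X := Sph d)).exists_bound_of_continuousOn hφc.continuousOn
    exact hfg.2.1.bdd_smul C hφc.aestronglyMeasurable (Eventually.of_forall fun x => hC x (Set.mem_univ _))
  have i2 : Integrable (fun η : Sph d => f η • tangProj η (gradient φ (η : Euc (d+1)))) (sphMeasure d) := by
    refine cont_integrable hd ?_
    unfold tangProj
    fun_prop
  have i3 : Integrable (fun η : Sph d => (f η * φ (η : Euc (d+1))) • (η : Euc (d+1))) (sphMeasure d) := by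
    refine cont_integrable hd ?_
    fun_prop
  rw [← integral_inner i1, ← integral_inner i2, ← integral_inner i3] at h
  simpa only [inner_smul_right] using h

lemma gradient_mul_inner {d : ℕ} {φ : Euc (d+1) → ℝ} (hφ : ContDiff ℝ (⊤ : ℕ∞) φ) (v x : Euc (d+1)) :
    gradient (fun y => φ y * ⟪y, v⟫) x = ⟪x, v⟫ • gradient φ x + φ x • v := by
  have h1 : HasGradientAt φ (gradient φ x) x :=
    ((hφ.differentiable (by simp)) x).hasGradientAt
  apply HasGradientAt.gradient
  rw [hasGradientAt_iff_hasFDerivAt] at h1 ⊢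
  have h2 : HasFDerivAt (fun y : Euc (d+1) => ⟪y, v⟫) (innerSL ℝ v) x := by
    have := (innerSL ℝ v).hasFDerivAt (x := x)
    refine this.congr_of_eventuallyEq (Eventually.of_forall fun y => ?_)
    simp [real_inner_comm]
  refine (h1.mul h2).congr_fderiv ?_
  ext y
  simp
  ring

lemma ibp {d : ℕ} (hd : 1 ≤ d) {f : Sph d → ℝ} {g : Sph d → Euc (d+1)} (hfg : MemW11 f g)
    (hf : Continuous f) {φ : Euc (d+1) → ℝ} (hφ : ContDiff ℝ (⊤ : ℕ∞) φ) (u v : Euc (d+1)) :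
    ∫ η, φ (η : Euc (d+1)) * ⟪g η, Sk u v η⟫ ∂(sphMeasure d) =
      - ∫ η, f η * ⟪gradient φ (η : Euc (d+1)), Sk u v η⟫ ∂(sphMeasure d) := by
  have hφc : Continuous (fun η : Sph d => φ η) := hφ.continuous.comp continuous_subtype_val
  have hgc : Continuous (fun η : Sph d => gradient φ (η : Euc (d+1))) :=
    (continuous_gradient hφ).comp continuous_subtype_val
  have s1 : ∀ w : Euc (d+1), ContDiff ℝ (⊤ : ℕ∞) (fun y => φ y * ⟪y, w⟫) := fun w =>
    hφ.mul (contDiff_id.inner ℝ contDiff_const)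
  have w1 := weak_inner hd hfg hf (s1 v) u
  have w2 := weak_inner hd hfg hf (s1 u) v
  have ig : ∀ w : Euc (d+1), Integrable (fun η => ⟪w, g η⟫) (sphMeasure d) := fun w =>
    hfg.2.1.const_inner w
  have i1 : ∀ w z : Euc (d+1), Integrable (fun η : Sph d => φ η * ⟪(η : Euc (d+1)), w⟫ * ⟪z, g η⟫)
      (sphMeasure d) := fun w z => contmul_integrable hd (ig z) (by fun_prop)
  have i2 : ∀ w z : Euc (d+1), Integrable (fun η : Sph d =>
      f η * ⟪z, tangProj η (gradient (fun y => φ y * ⟪y, w⟫) (η : Euc (d+1)))⟫) (sphMeasure d) := by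
    intro w z
    refine cont_integrable hd ?_
    simp only [gradient_mul_inner hφ]
    unfold tangProj
    fun_prop
  have e1 : ∫ η, φ (η : Euc (d+1)) * ⟪g η, Sk u v η⟫ ∂(sphMeasure d)
     = ∫ η : Sph d, φ η * ⟪(η : Euc (d+1)), v⟫ * ⟪u, g η⟫ ∂(sphMeasure d)
      - ∫ η : Sph d, φ η * ⟪(η : Euc (d+1)), u⟫ * ⟪v, g η⟫ ∂(sphMeasure d) := by
    rw [← integral_sub (i1 v u) (i1 u v)]
    congr 1; ext η
    simp only [Sk, inner_sub_right, inner_smul_right, real_inner_comm (g η)]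
    ring
  have e2 : ∫ η, f η * ⟪gradient φ (η : Euc (d+1)), Sk u v η⟫ ∂(sphMeasure d)
     = ∫ η, f η * ⟪u, tangProj η (gradient (fun y => φ y * ⟪y, v⟫) (η : Euc (d+1)))⟫ ∂(sphMeasure d)
      - ∫ η, f η * ⟪v, tangProj η (gradient (fun y => φ y * ⟪y, u⟫) (η : Euc (d+1)))⟫ ∂(sphMeasure d) := by
    rw [← integral_sub (i2 v u) (i2 u v)]
    congr 1; ext η
    simp only [gradient_mul_inner hφ, Sk, tangProj, inner_sub_right, inner_add_right, inner_smul_right,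
      inner_add_left, inner_smul_left]
    simp only [real_inner_comm u v, real_inner_comm (η : Euc (d+1)) u, real_inner_comm (η : Euc (d+1)) v,
      real_inner_comm (gradient φ (η : Euc (d+1)))]
    simp
    ring
  have e3 : ∫ η : Sph d, (f η * (φ η * ⟪(η : Euc (d+1)), v⟫)) * ⟪u, (η : Euc (d+1))⟫ ∂(sphMeasure d)
      = ∫ η : Sph d, (f η * (φ η * ⟪(η : Euc (d+1)), u⟫)) * ⟪v, (η : Euc (d+1))⟫ ∂(sphMeasure d) := by
    congr 1; ext η
    rw [real_inner_comm u, real_inner_comm v]; ring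
  rw [e1, e2, w1, w2, e3]
  ring

lemma exists_st_bound : ∃ M : ℝ, 0 < M ∧ ∀ x, |deriv Real.smoothTransition x| ≤ M := by
  have hc : Continuous (deriv Real.smoothTransition) :=
    (Real.smoothTransition.contDiff (n := 1)).continuous_deriv (by simp)
  obtain ⟨C, hC⟩ := (isCompact_Icc (a := (0:ℝ)) (b := 1)).exists_bound_of_continuousOn hc.continuousOn
  refine ⟨max C 1, by positivity, fun x => ?_⟩
  by_cases hx : x ∈ Set.Icc (0:ℝ) 1
  · exact (hC x hx).trans (le_max_left _ _)
  · have : deriv Real.smoothTransition x = 0 := by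
      rw [Set.mem_Icc, not_and_or, not_le, not_le] at hx
      rcases hx with hx | hx
      · have : Real.smoothTransition =ᶠ[𝓝 x] fun _ => 0 := by
          filter_upwards [Iio_mem_nhds hx] with y hy
          exact Real.smoothTransition.zero_of_nonpos (le_of_lt hy)
        rw [this.deriv_eq]; simp
      · have : Real.smoothTransition =ᶠ[𝓝 x] fun _ => 1 := by
          filter_upwards [Ioi_mem_nhds hx] with y hy
          exact Real.smoothTransition.one_of_one_le (le_of_lt hy)
        rw [this.deriv_eq]; simp
    rw [this]; simp

lemma st_deriv_zero {x : ℝ} (hx : x ≤ 0 ∨ 1 < x) : deriv Real.smoothTransition x = 0 := by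
  rcases hx with hx | hx
  · have : IsLocalMin Real.smoothTransition x := by
      refine Eventually.of_forall fun y => ?_
      rw [Real.smoothTransition.zero_of_nonpos hx]
      exact Real.smoothTransition.nonneg y
    exact this.deriv_eq_zero
  · have : IsLocalMax Real.smoothTransition x := by
      refine Eventually.of_forall fun y => ?_
      rw [Real.smoothTransition.one_of_one_le hx.le]
      exact Real.smoothTransition.le_one y
    exact this.deriv_eq_zero

/-- cutoff function -/
def cutoff {d : ℕ} (ζ : Sph d) (r s : ℝ) (x : Euc (d+1)) : ℝ :=
  Real.smoothTransition ((⟪(ζ : Euc (d+1)), x⟫ - Real.cos s) / (Real.cos r - Real.cos s))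

lemma cutoff_contDiff {d : ℕ} (ζ : Sph d) (r s : ℝ) : ContDiff ℝ (⊤ : ℕ∞) (cutoff ζ r s) := by
  unfold cutoff
  refine Real.smoothTransition.contDiff.comp ?_
  refine ContDiff.div_const ?_ _
  exact (contDiff_const.inner ℝ contDiff_id).sub contDiff_const

lemma cutoff_gradient {d : ℕ} (ζ : Sph d) (r s : ℝ) (x : Euc (d+1)) :
    gradient (cutoff ζ r s) x =
      (deriv Real.smoothTransition ((⟪(ζ : Euc (d+1)), x⟫ - Real.cos s) / (Real.cos r - Real.cos s))
        / (Real.cos r - Real.cos s)) • (ζ : Euc (d+1)) := by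
  apply HasGradientAt.gradient
  rw [hasGradientAt_iff_hasFDerivAt]
  have h1 : HasDerivAt Real.smoothTransition _
    ((⟪(ζ : Euc (d+1)), x⟫ - Real.cos s) / (Real.cos r - Real.cos s)) :=
    (((Real.smoothTransition.contDiff (n := 1)).differentiable (by simp)) _).hasDerivAt
  have h2 : HasFDerivAt (fun y : Euc (d+1) => (⟪(ζ : Euc (d+1)), y⟫ - Real.cos s) / (Real.cos r - Real.cos s))
      ((Real.cos r - Real.cos s)⁻¹ • innerSL ℝ (ζ : Euc (d+1))) x := by
    have := (((innerSL ℝ (ζ : Euc (d+1))).hasFDerivAt (x := x)).sub_const (Real.cos s)).const_smul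
      ((Real.cos r - Real.cos s)⁻¹)
    refine this.congr_of_eventuallyEq (Eventually.of_forall fun y => ?_)
    simp [div_eq_inv_mul]
  refine (h1.comp_hasFDerivAt x h2).congr_fderiv ?_
  ext y
  simp
  ring

lemma half_le_sin {x : ℝ} (h0 : 0 ≤ x) (h1 : x ≤ Real.pi/2) : x / 2 ≤ Real.sin x := by
  have := Real.mul_le_sin h0 h1
  have hpi := Real.pi_pos
  have h4 : 1/2 ≤ 2 / Real.pi := by
    rw [div_le_div_iff₀ (by norm_num) hpi]; linarith [Real.pi_le_four]
  nlinarith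

lemma cos_sub_cos_ge {r s : ℝ} (hr : 0 < r) (hrs : r < s) (hs : s ≤ Real.pi/2) :
    r * (s - r) / 4 ≤ Real.cos r - Real.cos s := by
  rw [Real.cos_sub_cos]
  have h1 := half_le_sin (x := (s+r)/2) (by linarith) (by linarith)
  have h2 := half_le_sin (x := (s-r)/2) (by linarith) (by linarith)
  have e : -2 * Real.sin ((r+s)/2) * Real.sin ((r-s)/2) = 2 * Real.sin ((s+r)/2) * Real.sin ((s-r)/2) := by
    rw [show (r-s)/2 = -((s-r)/2) by ring, Real.sin_neg, add_comm r s]; ring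
  rw [e]
  have h3 : ((s+r)/2/2) * ((s-r)/2/2) ≤ Real.sin ((s+r)/2) * Real.sin ((s-r)/2) := by
    have : 0 ≤ s - r := by linarith
    gcongr
    linarith
  nlinarith [mul_pos hr (sub_pos.2 hrs)]

lemma norm_sub_le_of_gball {d : ℕ} {ζ η : Sph d} {s : ℝ} (h0 : 0 ≤ s) (h1 : s ≤ Real.pi)
    (h : η ∈ gball ζ s) : ‖(η : Euc (d+1)) - ζ‖ ≤ s := by
  rw [mem_gball_iff h0 h1] at h
  have h2 := Real.one_sub_sq_div_two_le_cos (x := s)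
  refine le_of_sq_le_sq ?_ h0
  rw [norm_sub_sq_real, sph_norm, sph_norm, real_inner_comm]
  linarith

lemma cutoff_est {d : ℕ} (hd : 1 ≤ d) {M : ℝ} (hM : 0 < M)
    (hMst : ∀ x, |deriv Real.smoothTransition x| ≤ M)
    {f : Sph d → ℝ} {g : Sph d → Euc (d+1)} (hfg : MemW11 f g)
    (hf : Continuous f) (hf0 : ∀ η, 0 ≤ f η) {u v : Euc (d+1)} (hu : ‖u‖ ≤ 1) (hv : ‖v‖ ≤ 1)
    (ζ : Sph d) {r s : ℝ} (hr : 0 < r) (hr8 : r ≤ Real.pi / 8) (hrs : r < s) (hs : s ≤ 2 * r)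
    (hbest : ⨍ η in gball ζ s, f η ∂(sphMeasure d) ≤ ⨍ η in gball ζ r, f η ∂(sphMeasure d)) :
    |∫ η, cutoff ζ r s (η : Euc (d+1)) * ⟪g η, Sk u v η⟫ ∂(sphMeasure d)| ≤
      16 * M * C0 d * (⨍ η in gball ζ r, f η ∂(sphMeasure d)) * (sphMeasure d).real (gball ζ r) / r := by
  have := sphMeasure_finite hd
  have hpi := Real.pi_pos
  have hs0 : 0 < s - r := by linarith
  have hcc := cos_sub_cos_ge hr hrs (by linarith)
  have hcpos : 0 < Real.cos r - Real.cos s := lt_of_lt_of_le (by positivity) hcc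
  have hfi := cont_integrable hd hf
  set A := ⨍ η in gball ζ r, f η ∂(sphMeasure d) with hA
  have hA0 : 0 ≤ A := by
    rw [hA, setAverage_eq]
    exact smul_nonneg (by positivity) (integral_nonneg hf0)
  have hannf : ∫ η in gball ζ s \ gball ζ r, f η ∂(sphMeasure d) ≤
      A * (sphMeasure d).real (gball ζ s \ gball ζ r) := by
    rw [setIntegral_sdiff (measurableSet_gball _ _) hfi.integrableOn (gball_mono ζ hrs.le),
      measureReal_sdiff (gball_mono ζ hrs.le) (measurableSet_gball _ _)]
    have e1 : ∫ η in gball ζ r, f η ∂(sphMeasure d) = A * (sphMeasure d).real (gball ζ r) := by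
      rw [hA, setAverage_eq, smul_eq_mul]
      have := gball_pos hd ζ hr
      field_simp
    have e2 : ∫ η in gball ζ s, f η ∂(sphMeasure d) ≤ A * (sphMeasure d).real (gball ζ s) := by
      rw [setAverage_eq, smul_eq_mul] at hbest
      have := gball_pos hd ζ (hr.trans hrs)
      rwa [inv_mul_le_iff₀ this, mul_comm] at hbest
    rw [e1]; linarith
  rw [ibp hd hfg hf (cutoff_contDiff ζ r s), abs_neg]
  have hpt : ∀ η : Sph d, ‖f η * ⟪gradient (cutoff ζ r s) (η : Euc (d+1)), Sk u v η⟫‖ ≤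
      (gball ζ s \ gball ζ r).indicator (fun η => 16 * M / (s - r) * f η) η := by
    intro η
    rw [cutoff_gradient, inner_smul_left, Real.norm_eq_abs]
    simp only [RCLike.conj_to_real]
    by_cases hη : η ∈ gball ζ s \ gball ζ r
    · rw [Set.indicator_of_mem hη, abs_mul, abs_of_nonneg (hf0 η), abs_mul, abs_div, abs_of_pos hcpos]
      have h1 : |⟪(ζ : Euc (d+1)), Sk u v η⟫| ≤ 4 * r := by
        refine (Sk_inner_le hu hv _ _ (sph_norm ζ).le).trans ?_
        have := norm_sub_le_of_gball (by linarith) (by linarith) hη.1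
        linarith
      calc _ ≤ f η * (M / (r * (s - r) / 4) * (4 * r)) := by
            have := hf0 η
            gcongr
            exact hMst _
        _ = _ := by field_simp; ring
    · rw [Set.indicator_of_notMem hη, st_deriv_zero]
      · simp
      · by_cases h1 : η ∈ gball ζ s
        · right
          have h2 : η ∈ gball ζ r := by
            by_contra h; exact hη ⟨h1, h⟩
          rw [mem_gball_iff hr.le (by linarith)] at h2
          rw [lt_div_iff₀ hcpos]; linarith
        · left
          rw [mem_gball_iff (by linarith) (by linarith), not_lt] at h1
          exact div_nonpos_of_nonpos_of_nonneg (by linarith) hcpos.le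
  have hms : MeasurableSet (gball ζ s \ gball ζ r) :=
    (measurableSet_gball _ _).diff (measurableSet_gball _ _)
  rw [← Real.norm_eq_abs]
  refine (norm_integral_le_of_norm_le ((hfi.const_mul _).indicator hms) (Eventually.of_forall hpt)).trans ?_
  rw [integral_indicator hms, integral_const_mul]
  have h5 := annulus_le hd ζ hr hr8 hrs.le hs
  calc _ ≤ 16 * M / (s-r) * (A * (C0 d * ((s - r) / r) * (sphMeasure d).real (gball ζ r))) := by
        gcongr
        exact hannf.trans (by gcongr)
    _ = _ := by field_simp

lemma gsphere_null {d : ℕ} (hd : 1 ≤ d) (ζ : Sph d) {r : ℝ} (hr : 0 < r) (hr8 : r ≤ Real.pi / 8) :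
    sphMeasure d (gsphere ζ r) = 0 := by
  have := sphMeasure_finite hd
  rw [← measureReal_eq_zero_iff]
  refine le_antisymm ?_ measureReal_nonneg
  refine le_of_forall_pos_le_add fun ε hε => ?_
  rw [zero_add]
  set K := C0 d / r * (sphMeasure d).real (gball ζ r) with hK
  have hK0 : 0 < K := mul_pos (div_pos (C0_pos hd) hr) (gball_pos hd ζ hr)
  set δ := min r (ε / K) with hδ
  have hδ0 : 0 < δ := by positivity
  have h1 := annulus_le hd ζ hr hr8 (s := r + δ) (by linarith) (by linarith [min_le_left r (ε/K)])
  have h2 : (sphMeasure d).real (gsphere ζ r) ≤ (sphMeasure d).real (gball ζ (r+δ) \ gball ζ r) := by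
    refine measureReal_mono ?_
    intro η hη
    have hη' : geodist ζ η = r := hη
    refine ⟨?_, ?_⟩
    · change geodist ζ η < r + δ; linarith
    · change ¬ (geodist ζ η < r); linarith
  refine h2.trans (h1.trans ?_)
  calc _ = K * δ := by rw [hK]; field_simp; ring
    _ ≤ K * (ε / K) := by gcongr; exact min_le_right _ _
    _ = ε := by field_simp

lemma upper_est {d : ℕ} (hd : 1 ≤ d) {M : ℝ} (hM : 0 < M)
    (hMst : ∀ x, |deriv Real.smoothTransition x| ≤ M)
    {f : Sph d → ℝ} {g : Sph d → Euc (d+1)} (hfg : MemW11 f g)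
    (hf : Continuous f) (hf0 : ∀ η, 0 ≤ f η) {u v : Euc (d+1)} (hu : ‖u‖ ≤ 1) (hv : ‖v‖ ≤ 1)
    (ζ : Sph d) {r : ℝ} (hr : 0 < r) (hr8 : r ≤ Real.pi / 8)
    (hbest : ∀ s, r < s → s ≤ 2 * r →
      ⨍ η in gball ζ s, f η ∂(sphMeasure d) ≤ ⨍ η in gball ζ r, f η ∂(sphMeasure d)) :
    |∫ η in gball ζ r, ⟪g η, Sk u v η⟫ ∂(sphMeasure d)| ≤
      16 * M * C0 d * (⨍ η in gball ζ r, f η ∂(sphMeasure d)) * (sphMeasure d).real (gball ζ r) / r := by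
  have := sphMeasure_finite hd
  have hpi := Real.pi_pos
  let s : ℕ → ℝ := fun n => r + r * (1 / ((n:ℝ) + 1))
  have hs1 : ∀ n, r < s n := fun n => by
    have : 0 < r * (1 / ((n:ℝ) + 1)) := by positivity
    simp only [s]; linarith
  have hs2 : ∀ n, s n ≤ 2 * r := fun n => by
    have : 1 / ((n:ℝ) + 1) ≤ 1 := by
      rw [div_le_one (by positivity)]
      have : (0:ℝ) ≤ n := by positivity
      linarith
    simp only [s]; nlinarith
  have hs3 : Tendsto s atTop (𝓝 r) := by
    have := (tendsto_one_div_add_atTop_nhds_zero_nat (𝕜 := ℝ)).const_mul r |>.const_add r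
    simpa [s] using this
  have hgS : Integrable (fun η : Sph d => ⟪g η, Sk u v (η : Euc (d+1))⟫) (sphMeasure d) := by
    have i1 : ∀ w z : Euc (d+1), Integrable (fun η : Sph d => ⟪(η : Euc (d+1)), w⟫ * ⟪z, g η⟫)
      (sphMeasure d) := fun w z => contmul_integrable hd (hfg.2.1.const_inner z) (by fun_prop)
    refine ((i1 v u).sub (i1 u v)).congr (Eventually.of_forall fun η => ?_)
    simp only [Pi.sub_apply, Sk, inner_sub_right, inner_smul_right, real_inner_comm (g η)]
  have hlim : Tendsto (fun n => ∫ η, cutoff ζ r (s n) (η : Euc (d+1)) * ⟪g η, Sk u v η⟫ ∂(sphMeasure d))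
      atTop (𝓝 (∫ η, (gball ζ r).indicator (fun η => ⟪g η, Sk u v η⟫) η ∂(sphMeasure d))) := by
    refine tendsto_integral_of_dominated_convergence (fun η => ‖⟪g η, Sk u v η⟫‖) ?_ hgS.norm ?_ ?_
    · intro n
      exact (((cutoff_contDiff ζ r (s n)).continuous.comp continuous_subtype_val).aestronglyMeasurable).mul
        hgS.aestronglyMeasurable
    · intro n
      refine Eventually.of_forall fun η => ?_
      rw [norm_mul]
      have : ‖cutoff ζ r (s n) (η : Euc (d+1))‖ ≤ 1 := by
        unfold cutoff
        rw [Real.norm_eq_abs, abs_of_nonneg (Real.smoothTransition.nonneg _)]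
        exact Real.smoothTransition.le_one _
      have h0 := norm_nonneg ⟪g η, Sk u v η⟫
      nlinarith
    · have hnull : ∀ᵐ η ∂(sphMeasure d), η ∉ gsphere ζ r := by
        rw [ae_iff]; simpa using gsphere_null hd ζ hr hr8
      filter_upwards [hnull] with η hη
      have hc : ∀ n, 0 < Real.cos r - Real.cos (s n) := fun n => by
        have := cos_sub_cos_ge hr (hs1 n) (by linarith [hs2 n])
        have h2 := mul_pos hr (sub_pos.2 (hs1 n))
        linarith
      rcases lt_trichotomy (geodist ζ η) r with h | h | h
      · have hm : η ∈ gball ζ r := h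
        rw [Set.indicator_of_mem hm]
        refine tendsto_const_nhds.congr fun n => ?_
        rw [cutoff, Real.smoothTransition.one_of_one_le, one_mul]
        rw [mem_gball_iff hr.le (by linarith)] at hm
        rw [le_div_iff₀ (hc n)]; linarith
      · exact absurd h hη
      · have hm : η ∉ gball ζ r := not_lt.2 h.le
        rw [Set.indicator_of_notMem hm]
        refine tendsto_const_nhds.congr' ?_
        filter_upwards [hs3.eventually (gt_mem_nhds h)] with n hn
        have hm2 : η ∉ gball ζ (s n) := not_lt.2 (le_of_lt hn)
        rw [mem_gball_iff (by linarith [hs1 n]) (by linarith [hs2 n]), not_lt] at hm2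
        rw [cutoff, Real.smoothTransition.zero_of_nonpos, zero_mul]
        exact div_nonpos_of_nonpos_of_nonneg (by linarith) (hc n).le
  rw [integral_indicator (measurableSet_gball _ _)] at hlim
  refine le_of_tendsto hlim.abs (Eventually.of_forall fun n => ?_)
  exact cutoff_est hd hM hMst hfg hf hf0 hu hv ζ hr hr8 (hs1 n) (hs2 n) (hbest _ (hs1 n) (hs2 n))

lemma best_avg {d : ℕ} (hd : 1 ≤ d) {β : ℝ} (hβ : 0 < β) {f : Sph d → ℝ} (hf : Continuous f)
    (hf0 : ∀ η, 0 ≤ f η) {ξ ζ : Sph d} {r : ℝ} (hr : 0 < r) (hb : IsBestBall β f ξ ζ r)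
    {s : ℝ} (hrs : r < s) (hs : s ≤ Real.pi) :
    ⨍ η in gball ζ s, f η ∂(sphMeasure d) ≤ ⨍ η in gball ζ r, f η ∂(sphMeasure d) := by
  have := sphMeasure_finite hd
  obtain ⟨-, hrpi, hξ, hmax⟩ := hb
  have habs : ∀ η, |f η| = f η := fun η => abs_of_nonneg (hf0 η)
  have hnn : ∀ t, 0 ≤ ⨍ η in gball ζ t, f η ∂(sphMeasure d) := fun t => by
    rw [setAverage_eq]
    exact smul_nonneg (by positivity) (integral_nonneg hf0)
  obtain ⟨K, hK⟩ := (isCompact_univ (X := Sph d)).exists_bound_of_continuousOn hf.continuousOn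
  have hle : s ^ β * ⨍ η in gball ζ s, |f η| ∂(sphMeasure d) ≤ sphMax β f ξ := by
    refine le_csSup ⟨Real.pi ^ β * |K|, ?_⟩ ⟨ζ, s, hr.trans hrs, hs, hξ.trans hrs.le, rfl⟩
    rintro _ ⟨ζ', t, ht, htpi, -, rfl⟩
    have h1 : ⨍ η in gball ζ' t, |f η| ∂(sphMeasure d) ≤ |K| := by
      rw [setAverage_eq, smul_eq_mul, inv_mul_le_iff₀ (gball_pos hd ζ' ht)]
      have := setIntegral_mono_on (μ := sphMeasure d) (s := gball ζ' t) (f := fun η => |f η|) (g := fun _ => |K|)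
        (cont_integrable hd hf.abs).integrableOn (integrable_const _).integrableOn
        (measurableSet_gball _ _) (fun η _ => (hK η (Set.mem_univ _)).trans (le_abs_self _))
      rw [setIntegral_const, smul_eq_mul] at this
      exact this
    have h0 : 0 ≤ ⨍ η in gball ζ' t, |f η| ∂(sphMeasure d) := by
      rw [setAverage_eq]
      exact smul_nonneg (by positivity) (integral_nonneg fun _ => abs_nonneg _)
    gcongr
  rw [hmax] at hle
  simp only [habs] at hle
  have h2 : r ^ β ≤ s ^ β := Real.rpow_le_rpow hr.le hrs.le hβ.le
  have h3 : 0 < s ^ β := Real.rpow_pos_of_pos (hr.trans hrs) _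
  have h4 := mul_le_mul_of_nonneg_right h2 (hnn r)
  exact le_of_mul_le_mul_left (hle.trans h4) h3

/-- orthonormal pair -/
structure ONP {d : ℕ} (e p : Euc (d+1)) : Prop where
  ee : ⟪e, e⟫ = 1
  pp : ⟪p, p⟫ = 1
  ep : ⟪e, p⟫ = 0

lemma ONP.pe {d : ℕ} {e p : Euc (d+1)} (h : ONP e p) : ⟪p, e⟫ = 0 := by
  rw [real_inner_comm]; exact h.ep

/-- rotation by the angle `s` in the plane of `e` and `p` -/
def rotL {d : ℕ} (e p : Euc (d+1)) (s : ℝ) : Euc (d+1) →L[ℝ] Euc (d+1) :=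
  ContinuousLinearMap.id ℝ _ +
    (Real.cos s - 1) • ((innerSL ℝ e).smulRight e + (innerSL ℝ p).smulRight p) +
    Real.sin s • ((innerSL ℝ e).smulRight p - (innerSL ℝ p).smulRight e)

lemma rotL_apply {d : ℕ} (e p : Euc (d+1)) (s : ℝ) (x : Euc (d+1)) :
    rotL e p s x = x + (Real.cos s - 1) • (⟪e, x⟫ • e + ⟪p, x⟫ • p) +
      Real.sin s • (⟪e, x⟫ • p - ⟪p, x⟫ • e) := by
  simp [rotL]

lemma inner_e_rot {d : ℕ} {e p : Euc (d+1)} (h : ONP e p) (s : ℝ) (x : Euc (d+1)) :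
    ⟪e, rotL e p s x⟫ = Real.cos s * ⟪e, x⟫ - Real.sin s * ⟪p, x⟫ := by
  simp only [rotL_apply, inner_add_right, inner_sub_right, inner_smul_right, h.ee, h.ep]
  ring

lemma inner_p_rot {d : ℕ} {e p : Euc (d+1)} (h : ONP e p) (s : ℝ) (x : Euc (d+1)) :
    ⟪p, rotL e p s x⟫ = Real.cos s * ⟪p, x⟫ + Real.sin s * ⟪e, x⟫ := by
  simp only [rotL_apply, inner_add_right, inner_sub_right, inner_smul_right, h.pp, h.pe]
  ring

lemma rot_inner {d : ℕ} {e p : Euc (d+1)} (h : ONP e p) (s : ℝ) (x y : Euc (d+1)) :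
    ⟪rotL e p s x, rotL e p s y⟫ = ⟪x, y⟫ := by
  conv_lhs => rw [rotL_apply e p s x]
  simp only [inner_add_left, inner_sub_left, inner_smul_left, inner_e_rot h, inner_p_rot h,
    RCLike.conj_to_real]
  rw [rotL_apply]
  simp only [inner_add_right, inner_sub_right, inner_smul_right, real_inner_comm e x, real_inner_comm p x]
  linear_combination (⟪e, x⟫ * ⟪e, y⟫ + ⟪p, x⟫ * ⟪p, y⟫) * (Real.sin_sq_add_cos_sq s)

lemma rot_add {d : ℕ} {e p : Euc (d+1)} (h : ONP e p) (s t : ℝ) (x : Euc (d+1)) :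
    rotL e p s (rotL e p t x) = rotL e p (s + t) x := by
  rw [rotL_apply e p s, inner_e_rot h, inner_p_rot h, rotL_apply, rotL_apply, Real.cos_add, Real.sin_add]
  module

lemma rot_zero {d : ℕ} (e p : Euc (d+1)) (x : Euc (d+1)) : rotL e p 0 x = x := by
  simp [rotL_apply]

lemma rot_norm {d : ℕ} {e p : Euc (d+1)} (h : ONP e p) (s : ℝ) (x : Euc (d+1)) :
    ‖rotL e p s x‖ = ‖x‖ := by
  rw [norm_eq_sqrt_real_inner, rot_inner h, ← norm_eq_sqrt_real_inner]

lemma rot_Sk {d : ℕ} {e p : Euc (d+1)} (h : ONP e p) (s : ℝ) (x : Euc (d+1)) :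
    rotL e p s (Sk p e x) = Sk p e (rotL e p s x) := by
  unfold Sk
  rw [real_inner_comm e (rotL e p s x), inner_e_rot h, real_inner_comm p (rotL e p s x), inner_p_rot h, rotL_apply]
  simp only [inner_sub_right, inner_smul_right, h.ee, h.ep, h.pp, h.pe, real_inner_comm e x, real_inner_comm p x]
  module

lemma rot_hasDerivAt {d : ℕ} {e p : Euc (d+1)} (h : ONP e p) (s : ℝ) (x : Euc (d+1)) :
    HasDerivAt (fun s => rotL e p s x) (Sk p e (rotL e p s x)) s := by
  simp only [rotL_apply e p _ x]
  have h1 := (((Real.hasDerivAt_cos s).sub_const 1).smul_const (⟪e, x⟫ • e + ⟪p, x⟫ • p)).const_add x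
  have h2 := (Real.hasDerivAt_sin s).smul_const (⟪e, x⟫ • p - ⟪p, x⟫ • e)
  refine (h1.add h2).congr_deriv ?_
  rw [← rotL_apply]
  unfold Sk
  rw [real_inner_comm e (rotL e p s x), inner_e_rot h, real_inner_comm p (rotL e p s x), inner_p_rot h]
  module

lemma continuous_rot {d : ℕ} (e p : Euc (d+1)) :
    Continuous (fun q : ℝ × Euc (d+1) => rotL e p q.1 q.2) := by
  simp only [rotL_apply]
  fun_prop

/-- rotation of the sphere -/
def Trot {d : ℕ} {e p : Euc (d+1)} (h : ONP e p) (s : ℝ) (η : Sph d) : Sph d :=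
  ⟨rotL e p s η, by rw [mem_sphere_zero_iff_norm, rot_norm h, sph_norm]⟩

lemma continuous_Trot {d : ℕ} {e p : Euc (d+1)} (h : ONP e p) :
    Continuous (fun q : ℝ × Sph d => Trot h q.1 q.2) := by
  refine continuous_induced_rng.2 ?_
  change Continuous (fun q : ℝ × Sph d => rotL e p q.1 (q.2 : Euc (d+1)))
  simp only [rotL_apply]
  fun_prop

lemma continuous_Trot_right {d : ℕ} {e p : Euc (d+1)} (h : ONP e p) (s : ℝ) :
    Continuous (Trot h s) := by
  refine continuous_induced_rng.2 ?_
  change Continuous (fun η : Sph d => rotL e p s (η : Euc (d+1)))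
  simp only [rotL_apply]
  fun_prop

lemma continuous_Trot_left {d : ℕ} {e p : Euc (d+1)} (h : ONP e p) (η : Sph d) :
    Continuous (fun s => Trot h s η) := by
  refine continuous_induced_rng.2 ?_
  change Continuous (fun s : ℝ => rotL e p s (η : Euc (d+1)))
  simp only [rotL_apply]
  fun_prop

lemma Trot_add {d : ℕ} {e p : Euc (d+1)} (h : ONP e p) (s t : ℝ) (η : Sph d) :
    Trot h s (Trot h t η) = Trot h (s + t) η := Subtype.ext (rot_add h s t η)

lemma Trot_zero {d : ℕ} {e p : Euc (d+1)} (h : ONP e p) (η : Sph d) :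
    Trot h 0 η = η := Subtype.ext (rot_zero e p η)

lemma Trot_preserving {d : ℕ} {e p : Euc (d+1)} (h : ONP e p) (s : ℝ) :
    MeasurePreserving (Trot h s) (sphMeasure d) (sphMeasure d) := by
  let T : Sph d ≃ᵢ Sph d :=
    { toFun := Trot h s
      invFun := Trot h (-s)
      left_inv := fun η => by rw [Trot_add]; simp [Trot_zero]
      right_inv := fun η => by rw [Trot_add]; simp [Trot_zero]
      isometry_toFun := by
        refine Isometry.of_dist_eq fun x y => ?_
        rw [Subtype.dist_eq, Subtype.dist_eq, dist_eq_norm, dist_eq_norm]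
        simp only [Trot]
        rw [← map_sub, rot_norm h] }
  rw [sphMeasure_eq]
  exact T.measurePreserving_hausdorffMeasure _

lemma Trot_embedding {d : ℕ} {e p : Euc (d+1)} (h : ONP e p) (s : ℝ) :
    MeasurableEmbedding (Trot h s) := by
  let T : Sph d ≃ₜ Sph d :=
    { toFun := Trot h s
      invFun := Trot h (-s)
      left_inv := fun η => by rw [Trot_add]; simp [Trot_zero]
      right_inv := fun η => by rw [Trot_add]; simp [Trot_zero]
      continuous_toFun := continuous_Trot_right h s
      continuous_invFun := continuous_Trot_right h (-s) }
  exact T.measurableEmbedding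

lemma Trot_integral {d : ℕ} {e p : Euc (d+1)} (h : ONP e p) (s : ℝ) (F : Sph d → ℝ) :
    ∫ η, F (Trot h s η) ∂(sphMeasure d) = ∫ η, F η ∂(sphMeasure d) :=
  (Trot_preserving h s).integral_comp (Trot_embedding h s) F

lemma Trot_integrable_prod {d : ℕ} (hd : 1 ≤ d) {e p : Euc (d+1)} (h : ONP e p) {F : Sph d → ℝ}
    (hF : Integrable F (sphMeasure d)) (μ : Measure ℝ) [IsFiniteMeasure μ] :
    Integrable (fun q : ℝ × Sph d => F (Trot h q.1 q.2)) (μ.prod (sphMeasure d)) := by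
  have := sphMeasure_finite hd
  have hmp := (MeasurePreserving.id μ).skew_product (μc := sphMeasure d) (μd := sphMeasure d)
    (g := fun s η => Trot h s η)
    (continuous_Trot h).measurable (Eventually.of_forall fun s => (Trot_preserving h s).map_eq)
  exact hmp.integrable_comp_of_integrable (hF.comp_snd μ)

lemma smooth_density {d : ℕ} {H : Sph d → ℝ} (hH : Integrable H (sphMeasure d))
    (h : ∀ φ : Euc (d+1) → ℝ, ContDiff ℝ (⊤ : ℕ∞) φ →
      ∫ η, φ (η : Euc (d+1)) * H η ∂(sphMeasure d) = 0) :
    ∀ᵐ η ∂(sphMeasure d), H η = 0 := by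
  have hm : MeasurableEmbedding (Subtype.val : Sph d → Euc (d+1)) :=
    MeasurableEmbedding.subtype_coe (Metric.isClosed_sphere.measurableSet)
  let H' : Euc (d+1) → ℝ := Function.extend Subtype.val H 0
  have hH' : ∀ η : Sph d, H' η = H η := fun η => Subtype.val_injective.extend_apply _ _ _
  have key := ae_eq_zero_of_integral_contDiff_smul_eq_zero (μ := (sphMeasure d).map Subtype.val)
    (f := H') ?_ ?_
  · rw [hm.ae_map_iff] at key
    filter_upwards [key] with η hη
    rwa [hH'] at hη
  · refine Integrable.locallyIntegrable ?_
    rw [hm.integrable_map_iff]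
    exact hH.congr (Eventually.of_forall fun η => (hH' η).symm)
  · intro φ hφ _
    rw [hm.integral_map]
    simp only [hH', smul_eq_mul]
    exact h φ hφ

lemma gS_integrable {d : ℕ} (hd : 1 ≤ d) {g : Sph d → Euc (d+1)} (hg : Integrable g (sphMeasure d))
    (u v : Euc (d+1)) :
    Integrable (fun η : Sph d => ⟪g η, Sk u v (η : Euc (d+1))⟫) (sphMeasure d) := by
  have i1 : ∀ w z : Euc (d+1), Integrable (fun η : Sph d => ⟪(η : Euc (d+1)), w⟫ * ⟪z, g η⟫)
    (sphMeasure d) := fun w z => contmul_integrable hd (hg.const_inner z) (by fun_prop)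
  refine ((i1 v u).sub (i1 u v)).congr (Eventually.of_forall fun η => ?_)
  simp only [Pi.sub_apply, Sk, inner_sub_right, inner_smul_right, real_inner_comm (g η)]

lemma flow_deriv {d : ℕ} (hd : 1 ≤ d) {f : Sph d → ℝ} {g : Sph d → Euc (d+1)} (hfg : MemW11 f g)
    (hf : Continuous f) {e p : Euc (d+1)} (h : ONP e p)
    {φ : Euc (d+1) → ℝ} (hφ : ContDiff ℝ (⊤ : ℕ∞) φ) (t : ℝ) :
    HasDerivAt (fun t => ∫ η, φ (η : Euc (d+1)) * f (Trot h t η) ∂(sphMeasure d))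
      (∫ η, φ (Trot h (-t) η : Euc (d+1)) * ⟪g η, Sk p e η⟫ ∂(sphMeasure d)) t := by
  have := sphMeasure_finite hd
  have e1 : (fun t => ∫ η, φ (η : Euc (d+1)) * f (Trot h t η) ∂(sphMeasure d))
      = fun t => ∫ η, f η * φ (rotL e p (-t) (η : Euc (d+1))) ∂(sphMeasure d) := by
    funext t
    rw [← Trot_integral h (-t)]
    congr 1; ext η
    rw [Trot_add, add_neg_cancel, Trot_zero, mul_comm]
    rfl
  rw [e1]
  have hgc := continuous_gradient hφ
  have hpc : ∀ t, Continuous (fun η : Sph d => rotL e p (-t) (η : Euc (d+1))) := fun t =>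
    (rotL e p (-t)).continuous.comp continuous_subtype_val
  let F' : ℝ → Sph d → ℝ := fun t η =>
    f η * -⟪gradient φ (rotL e p (-t) η), Sk p e (rotL e p (-t) η)⟫
  have hF'c : ∀ t, Continuous (F' t) := fun t =>
    hf.mul ((hgc.comp (hpc t)).inner ((continuous_Sk p e).comp (hpc t))).neg
  have hdiff : ∀ t (η : Sph d), HasDerivAt (fun t => f η * φ (rotL e p (-t) (η : Euc (d+1)))) (F' t η) t := by
    intro t η
    have h1 : HasDerivAt (fun t => rotL e p (-t) (η : Euc (d+1))) (-Sk p e (rotL e p (-t) η)) t := by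
      have := (rot_hasDerivAt h (-t) (η : Euc (d+1))).scomp t (hasDerivAt_neg t)
      simpa [Function.comp_def] using this
    have h2 := ((hφ.differentiable (by simp)) (rotL e p (-t) η)).hasFDerivAt.comp_hasDerivAt t h1
    refine (h2.const_mul (f η)).congr_deriv ?_
    simp only [F', inner_gradient_left, map_neg]
  obtain ⟨C1, hC1⟩ := (isCompact_univ (X := Sph d)).exists_bound_of_continuousOn hf.continuousOn
  obtain ⟨C2, hC2⟩ := (isCompact_univ (X := Sph d)).exists_bound_of_continuousOn
    (f := fun η : Sph d => ⟪gradient φ (η : Euc (d+1)), Sk p e η⟫)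
    ((hgc.comp continuous_subtype_val).inner ((continuous_Sk p e).comp continuous_subtype_val)).continuousOn
  have hbd : ∀ t (η : Sph d), ‖F' t η‖ ≤ C1 * C2 := by
    intro t η
    have h1 := hC1 η (Set.mem_univ _)
    have h2 := hC2 (Trot h (-t) η) (Set.mem_univ _)
    simp only [F', norm_mul, norm_neg]
    exact mul_le_mul h1 h2 (norm_nonneg _) ((norm_nonneg _).trans h1)
  have key := hasDerivAt_integral_of_dominated_loc_of_deriv_le (μ := sphMeasure d) (x₀ := t)
    (F := fun t (η : Sph d) => f η * φ (rotL e p (-t) (η : Euc (d+1)))) (F' := F')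
    (bound := fun _ => C1 * C2) (s := Set.univ) univ_mem
    (Eventually.of_forall fun t => (hf.mul (hφ.continuous.comp (hpc t))).aestronglyMeasurable)
    (cont_integrable hd (hf.mul (hφ.continuous.comp (hpc t))))
    (hF'c t).aestronglyMeasurable
    (Eventually.of_forall fun η x _ => hbd x η) (integrable_const _)
    (Eventually.of_forall fun η x _ => hdiff x η)
  refine key.2.congr_deriv ?_
  have hcomp : ContDiff ℝ (⊤ : ℕ∞) (fun x => φ (rotL e p (-t) x)) :=
    hφ.comp (rotL e p (-t)).contDiff
  have := ibp hd hfg hf hcomp p e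
  change _ = ∫ η : Sph d, (fun x => φ (rotL e p (-t) x)) (η : Euc (d+1)) * _ ∂_
  rw [this, ← integral_neg]
  congr 1; ext η
  simp only [F', inner_gradient_left]
  rw [fderiv_fun_comp (η : Euc (d+1)) ((hφ.differentiable (by simp)) _) (rotL e p (-t)).differentiableAt,
    ContinuousLinearMap.fderiv]
  simp [rot_Sk h]

lemma flow_eq {d : ℕ} (hd : 1 ≤ d) {f : Sph d → ℝ} {g : Sph d → Euc (d+1)} (hfg : MemW11 f g)
    (hf : Continuous f) {e p : Euc (d+1)} (h : ONP e p) (t : ℝ) :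
    ∀ᵐ η ∂(sphMeasure d), f (Trot h t η) - f η =
      ∫ s in (0:ℝ)..t, ⟪g (Trot h s η), Sk p e (Trot h s η)⟫ := by
  have := sphMeasure_finite hd
  have : IsFiniteMeasure (volume.restrict (Set.uIoc 0 t)) := by
    unfold Set.uIoc; infer_instance
  set k : Sph d → ℝ := fun η => ⟪g η, Sk p e η⟫ with hk
  have hki : Integrable k (sphMeasure d) := gS_integrable hd hfg.2.1 p e
  have hTc : Continuous (Trot h t) := continuous_Trot_right h t
  have hprod : Integrable (fun q : ℝ × Sph d => k (Trot h q.1 q.2))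
      ((volume.restrict (Set.uIoc 0 t)).prod (sphMeasure d)) := Trot_integrable_prod hd h hki _
  have hint : Integrable (fun η => ∫ s in (0:ℝ)..t, k (Trot h s η)) (sphMeasure d) := by
    simp only [intervalIntegral.intervalIntegral_eq_integral_uIoc]
    exact hprod.integral_prod_right.smul (if 0 ≤ t then (1:ℝ) else -1)
  have hfd : Integrable (fun η => f (Trot h t η) - f η) (sphMeasure d) :=
    cont_integrable hd ((hf.comp hTc).sub hf)
  have hz := smooth_density (hfd.sub hint) ?_
  · filter_upwards [hz] with η hη
    simp only [Pi.sub_apply] at hη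
    linarith
  intro φ hφ
  have hφc : Continuous (fun η : Sph d => φ η) := hφ.continuous.comp continuous_subtype_val
  obtain ⟨C, hC⟩ := (isCompact_univ (X := Sph d)).exists_bound_of_continuousOn hφc.continuousOn
  have hcont : Continuous (fun t => ∫ η, φ (Trot h (-t) η : Euc (d+1)) * k η ∂(sphMeasure d)) := by
    refine continuous_of_dominated (bound := fun η => C * ‖k η‖) ?_ ?_ (hki.norm.const_mul _) ?_
    · intro t
      refine AEStronglyMeasurable.mul (Continuous.aestronglyMeasurable ?_) hki.aestronglyMeasurable
      exact hφc.comp (continuous_Trot_right h (-t))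
    · intro t
      refine Eventually.of_forall fun η => ?_
      rw [norm_mul]
      gcongr
      exact hC _ (Set.mem_univ _)
    · refine Eventually.of_forall fun η => ?_
      refine Continuous.mul ?_ continuous_const
      exact hφc.comp ((continuous_Trot_left h η).comp continuous_neg)
  have ftc := intervalIntegral.integral_eq_sub_of_hasDerivAt (a := 0) (b := t)
    (fun s _ => flow_deriv hd hfg hf h hφ s) (hcont.intervalIntegrable 0 t)
  have e1 : ∀ s, ∫ η, φ (Trot h (-s) η : Euc (d+1)) * k η ∂(sphMeasure d) =
      ∫ η, φ (η : Euc (d+1)) * k (Trot h s η) ∂(sphMeasure d) := by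
    intro s
    rw [← Trot_integral h s]
    congr 1; ext η
    rw [Trot_add, neg_add_cancel, Trot_zero]
  have hprod2 : Integrable (Function.uncurry fun s (η : Sph d) => φ (η : Euc (d+1)) * k (Trot h s η))
      ((volume.restrict (Set.uIoc 0 t)).prod (sphMeasure d)) := by
    refine hprod.bdd_mul (c := C) (hφc.comp continuous_snd).aestronglyMeasurable ?_
    exact Eventually.of_forall fun q => hC _ (Set.mem_univ _)
  change ∫ s in (0:ℝ)..t, ∫ η, φ (Trot h (-s) η : Euc (d+1)) * k η ∂(sphMeasure d) = _ at ftc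
  simp only [e1] at ftc
  rw [intervalIntegral_integral_swap hprod2] at ftc
  simp only [intervalIntegral.integral_const_mul, Trot_zero] at ftc
  have i1 : Integrable (fun η : Sph d => φ η * (f (Trot h t η) - f η)) (sphMeasure d) :=
    contmul_integrable hd hfd hφc
  have i2 : Integrable (fun η : Sph d => φ η * ∫ s in (0:ℝ)..t, k (Trot h s η)) (sphMeasure d) :=
    contmul_integrable hd hint hφc
  have i3 : Integrable (fun η : Sph d => φ η * f (Trot h t η)) (sphMeasure d) :=
    cont_integrable hd (hφc.mul (hf.comp hTc))
  have i4 : Integrable (fun η : Sph d => φ η * f η) (sphMeasure d) :=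
    cont_integrable hd (hφc.mul hf)
  simp only [Pi.sub_apply, mul_sub (φ _) (_ - _) _]
  rw [integral_sub i1 i2, ftc]
  simp only [mul_sub]
  rw [integral_sub i3 i4, sub_self]

lemma flow_ae {d : ℕ} (hd : 1 ≤ d) {f : Sph d → ℝ} {g : Sph d → Euc (d+1)} (hfg : MemW11 f g)
    (hf : Continuous f) {e p : Euc (d+1)} (h : ONP e p) :
    ∀ᵐ η ∂(sphMeasure d),
      (∀ a b, IntervalIntegrable (fun s => ⟪g (Trot h s η), Sk p e (Trot h s η)⟫) volume a b) ∧
      ∀ t, f (Trot h t η) - f η = ∫ s in (0:ℝ)..t, ⟪g (Trot h s η), Sk p e (Trot h s η)⟫ := by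
  have := sphMeasure_finite hd
  set k : Sph d → ℝ := fun η => ⟪g η, Sk p e η⟫ with hk
  have hki : Integrable k (sphMeasure d) := gS_integrable hd hfg.2.1 p e
  have h1 : ∀ᵐ η ∂(sphMeasure d), ∀ N : ℕ,
      IntegrableOn (fun s => k (Trot h s η)) (Set.Icc (-(N:ℝ)) N) := by
    rw [ae_all_iff]
    intro N
    exact (Trot_integrable_prod hd h hki (volume.restrict (Set.Icc (-(N:ℝ)) N))).prod_left_ae
  have h2 : ∀ᵐ η ∂(sphMeasure d), ∀ q : ℚ, f (Trot h q η) - f η =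
      ∫ s in (0:ℝ)..q, k (Trot h s η) := by
    rw [ae_all_iff]
    intro q
    exact flow_eq hd hfg hf h q
  filter_upwards [h1, h2] with η h1 h2
  have hii : ∀ a b, IntervalIntegrable (fun s => k (Trot h s η)) volume a b := by
    intro a b
    obtain ⟨N, hN⟩ := exists_nat_ge (max |a| |b|)
    have ha := (abs_le.1 ((le_max_left _ _).trans hN))
    have hb := (abs_le.1 ((le_max_right _ _).trans hN))
    rw [intervalIntegrable_iff']
    refine (h1 N).mono_set ?_
    exact Set.uIcc_subset_Icc ⟨ha.1, ha.2⟩ ⟨hb.1, hb.2⟩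
  refine ⟨hii, fun t => ?_⟩
  have c1 : Continuous (fun t => f (Trot h t η) - f η) :=
    (hf.comp (continuous_Trot_left h η)).sub continuous_const
  have c2 := intervalIntegral.continuous_primitive hii 0
  have := Continuous.ext_on Rat.denseRange_cast c1 c2 (by
    rintro _ ⟨q, rfl⟩; exact h2 q)
  exact congrFun this t

lemma geodist_angle {d : ℕ} (x y : Sph d) :
    geodist x y = InnerProductGeometry.angle (x : Euc (d+1)) (y : Euc (d+1)) := by
  unfold geodist InnerProductGeometry.angle
  rw [sph_norm, sph_norm]; simp

lemma geodist_comm {d : ℕ} (x y : Sph d) : geodist x y = geodist y x := by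
  unfold geodist; rw [real_inner_comm]

lemma geodist_tri {d : ℕ} (x y z : Sph d) : geodist x z ≤ geodist x y + geodist y z := by
  simp only [geodist_angle]
  exact InnerProductGeometry.angle_le_angle_add_angle _ _ _

lemma geodist_Trot {d : ℕ} {e p : Euc (d+1)} (h : ONP e p) (s : ℝ) (x y : Sph d) :
    geodist (Trot h s x) (Trot h s y) = geodist x y := by
  unfold geodist Trot
  simp only [rot_inner h]

lemma geodist_Trot_self {d : ℕ} {e p : Euc (d+1)} (h : ONP e p) {s θ : ℝ} (hs : |s| ≤ Real.pi)
    (ζ : Sph d) (h1 : ⟪e, (ζ : Euc (d+1))⟫ = Real.cos θ) (h2 : ⟪p, (ζ : Euc (d+1))⟫ = Real.sin θ) :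
    geodist ζ (Trot h s ζ) = |s| := by
  have : ⟪(ζ : Euc (d+1)), rotL e p s ζ⟫ = Real.cos s := by
    rw [rotL_apply]
    simp only [inner_add_right, inner_sub_right, inner_smul_right, real_inner_comm e (ζ : Euc (d+1)),
      real_inner_comm p (ζ : Euc (d+1)), h1, h2, sph_inner_self]
    linear_combination (Real.cos s - 1) * Real.sin_sq_add_cos_sq θ
  unfold geodist Trot
  simp only [this]
  rw [← Real.cos_abs, Real.arccos_cos (abs_nonneg _) hs]

lemma exists_frame {d : ℕ} (ζ : Sph d) (h0 : 0 < polarAngle ζ) (hpi : polarAngle ζ < Real.pi) :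
    ∃ p : Euc (d+1), ONP (npole d : Euc (d+1)) p ∧
      ⟪(npole d : Euc (d+1)), (ζ : Euc (d+1))⟫ = Real.cos (polarAngle ζ) ∧
      ⟪p, (ζ : Euc (d+1))⟫ = Real.sin (polarAngle ζ) := by
  have hs : 0 < Real.sin (polarAngle ζ) := Real.sin_pos_of_pos_of_lt_pi h0 hpi
  have hc : ⟪(npole d : Euc (d+1)), (ζ : Euc (d+1))⟫ = Real.cos (polarAngle ζ) := by
    unfold polarAngle geodist
    rw [Real.cos_arccos (sph_inner_ge _ _) (sph_inner_le _ _)]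
  set θ := polarAngle ζ
  have hcs := Real.sin_sq_add_cos_sq θ
  refine ⟨(Real.sin θ)⁻¹ • ((ζ : Euc (d+1)) - Real.cos θ • (npole d : Euc (d+1))), ⟨?_, ?_, ?_⟩, hc, ?_⟩
  · exact sph_inner_self _
  · simp only [inner_smul_left, inner_smul_right, inner_sub_left, inner_sub_right, hc, sph_inner_self,
      real_inner_comm (npole d : Euc (d+1)) (ζ : Euc (d+1)), RCLike.conj_to_real]
    field_simp
    linear_combination -hcs
  · simp only [inner_smul_left, inner_smul_right, inner_sub_left, inner_sub_right, hc, sph_inner_self]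
    ring
  · simp only [inner_smul_left, inner_smul_right, inner_sub_left, inner_sub_right, hc, sph_inner_self,
      RCLike.conj_to_real]
    field_simp
    linear_combination -hcs

lemma sub_interval_aux {u : ℝ → ℝ} (hu : Continuous u) {x y p q : ℝ} (hxy : x ≤ y)
    (hx : u x ≤ p) (hy : q ≤ u y) (hpq : p < q) :
    ∃ a b, x ≤ a ∧ a ≤ b ∧ b ≤ y ∧ q - p ≤ |u b - u a| ∧ ∀ s ∈ Set.Ioo a b, p ≤ u s ∧ u s ≤ q := by
  have c1 : IsCompact (Set.Icc x y ∩ {s | u s ≤ p}) :=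
    isCompact_Icc.inter_right (isClosed_le hu continuous_const)
  obtain ⟨a, ⟨ha, ha'⟩, hamax⟩ := c1.exists_isGreatest ⟨x, ⟨le_refl _, hxy⟩, hx⟩
  have c2 : IsCompact (Set.Icc a y ∩ {s | q ≤ u s}) :=
    isCompact_Icc.inter_right (isClosed_le continuous_const hu)
  obtain ⟨b, ⟨hb, hb'⟩, hbmin⟩ := c2.exists_isLeast ⟨y, ⟨ha.2, le_refl _⟩, hy⟩
  simp only [Set.mem_ofPred_eq] at ha' hb'
  refine ⟨a, b, ha.1, hb.1, hb.2, ?_, ?_⟩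
  · exact le_trans (by linarith) (le_abs_self _)
  · intro s hs
    constructor
    · by_contra hc
      have := hamax ⟨⟨ha.1.trans hs.1.le, hs.2.le.trans hb.2⟩, (not_le.1 hc).le⟩
      exact absurd hs.1 (not_lt.2 this)
    · by_contra hc
      have := hbmin ⟨⟨hs.1.le, hs.2.le.trans hb.2⟩, (not_le.1 hc).le⟩
      exact absurd hs.2 (not_lt.2 this)

lemma sub_interval {u : ℝ → ℝ} (hu : Continuous u) {x y p q c : ℝ} (hxc : |x| ≤ c) (hyc : |y| ≤ c)
    (hx : u x ≤ p) (hy : q ≤ u y) (hpq : p < q) :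
    ∃ a b, -c ≤ a ∧ a ≤ b ∧ b ≤ c ∧ q - p ≤ |u b - u a| ∧ ∀ s ∈ Set.Ioo a b, p ≤ u s ∧ u s ≤ q := by
  rw [abs_le] at hxc hyc
  rcases le_total x y with hxy | hxy
  · obtain ⟨a, b, h1, h2, h3, h4, h5⟩ := sub_interval_aux hu hxy hx hy hpq
    exact ⟨a, b, hxc.1.trans h1, h2, h3.trans hyc.2, h4, h5⟩
  · obtain ⟨a, b, h1, h2, h3, h4, h5⟩ := sub_interval_aux (u := fun s => u (-s)) (x := -x) (y := -y)
      (hu.comp continuous_neg) (by linarith) (by simpa using hx) (by simpa using hy) hpq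
    refine ⟨-b, -a, by linarith, by linarith, by linarith, by rwa [abs_sub_comm], ?_⟩
    intro s hs
    have := h5 (-s) ⟨by linarith [hs.2], by linarith [hs.1]⟩
    simpa using this

lemma flow_lower {d : ℕ} {f : Sph d → ℝ} {g : Sph d → Euc (d+1)}
    (hf : Continuous f) {e p : Euc (d+1)} (h : ONP e p) {P Q c : ℝ} (hPQ : P < Q) (U : Set (Sph d))
    (η : Sph d) (hU : ∀ s, |s| ≤ c → Trot h s η ∈ U)
    (hi : ∀ a b, IntervalIntegrable (fun s => ⟪g (Trot h s η), Sk p e (Trot h s η)⟫) volume a b)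
    (hfl : ∀ t, f (Trot h t η) - f η = ∫ s in (0:ℝ)..t, ⟪g (Trot h s η), Sk p e (Trot h s η)⟫)
    (hG : IntegrableOn (fun s => Set.indicator (U ∩ {η' | P ≤ f η' ∧ f η' ≤ Q}) (fun η' => 2 * ‖g η'‖)
      (Trot h s η)) (Set.Icc (-c) c))
    {x y : ℝ} (hx : |x| ≤ c) (hy : |y| ≤ c) (hfx : f (Trot h x η) ≤ P) (hfy : Q ≤ f (Trot h y η)) :
    Q - P ≤ ∫ s in Set.Icc (-c) c, Set.indicator (U ∩ {η' | P ≤ f η' ∧ f η' ≤ Q})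
      (fun η' => 2 * ‖g η'‖) (Trot h s η) := by
  obtain ⟨a, b, h1, h2, h3, h4, h5⟩ := sub_interval (u := fun s => f (Trot h s η))
    (hf.comp (continuous_Trot_left h η)) hx hy hfx hfy hPQ
  have hp : ‖p‖ ≤ 1 := by rw [norm_eq_sqrt_real_inner, h.pp]; simp
  have he : ‖e‖ ≤ 1 := by rw [norm_eq_sqrt_real_inner, h.ee]; simp
  have e1 : f (Trot h b η) - f (Trot h a η) =
      ∫ s in a..b, ⟪g (Trot h s η), Sk p e (Trot h s η)⟫ := by
    rw [← intervalIntegral.integral_interval_sub_left (hi 0 b) (hi 0 a), ← hfl, ← hfl]; ring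
  have hsub : Set.Ioo a b ⊆ Set.Icc (-c) c := fun s hs => ⟨h1.trans hs.1.le, hs.2.le.trans h3⟩
  calc Q - P ≤ |∫ s in a..b, ⟪g (Trot h s η), Sk p e (Trot h s η)⟫| := by rw [← e1]; exact h4
    _ ≤ ∫ s in a..b, |⟪g (Trot h s η), Sk p e (Trot h s η)⟫| :=
        intervalIntegral.abs_integral_le_integral_abs h2
    _ = ∫ s in Set.Ioo a b, |⟪g (Trot h s η), Sk p e (Trot h s η)⟫| := by
        rw [intervalIntegral.integral_of_le h2, integral_Ioc_eq_integral_Ioo]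
    _ ≤ ∫ s in Set.Ioo a b, Set.indicator (U ∩ {η' | P ≤ f η' ∧ f η' ≤ Q})
          (fun η' => 2 * ‖g η'‖) (Trot h s η) := by
        refine setIntegral_mono_on ?_ (hG.mono_set hsub) measurableSet_Ioo ?_
        · have := (hi a b).abs
          rw [intervalIntegrable_iff_integrableOn_Ioo_of_le h2] at this
          exact this
        · intro s hs
          have hm : Trot h s η ∈ U ∩ {η' | P ≤ f η' ∧ f η' ≤ Q} :=
            ⟨hU s (abs_le.2 (hsub hs)), h5 s hs⟩
          rw [Set.indicator_of_mem hm]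
          refine (abs_real_inner_le_norm _ _).trans ?_
          have := Sk_norm_le hp he (Trot h s η : Euc (d+1))
          rw [sph_norm] at this
          nlinarith [norm_nonneg (g (Trot h s η))]
    _ ≤ _ := by
        refine setIntegral_mono_set hG (Eventually.of_forall fun s => ?_) hsub.eventuallyLE
        exact Set.indicator_nonneg (fun _ _ => by positivity) _

lemma polar_eq {d : ℕ} {f : Sph d → ℝ} (hp : IsPolar f) {x y : Sph d} (h : polarAngle x = polarAngle y) :
    f x = f y := by
  apply hp
  have := Real.arccos_injOn ⟨sph_inner_ge _ _, sph_inner_le _ _⟩ ⟨sph_inner_ge _ _, sph_inner_le _ _⟩ h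
  rw [real_inner_comm, this, real_inner_comm]

lemma lower_est {d : ℕ} (hd : 1 ≤ d) {f : Sph d → ℝ} {g : Sph d → Euc (d+1)} (hfg : MemW11 f g)
    (hf : Continuous f) (hpol : IsPolar f) (ζ : Sph d) {r : ℝ} (hr : 0 < r) (hrw : r ≤ sphWidth ζ / 4)
    {P Q : ℝ} (hPQ : P < Q) {η1 η2 : Sph d} (h1 : η1 ∈ gball ζ r) (h2 : η2 ∈ gball ζ r)
    (hf1 : f η1 ≤ P) (hf2 : Q ≤ f η2) :
    (Q - P) * (sphMeasure d).real (gball ζ (r/2)) ≤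
      3 * r * ∫ η, Set.indicator (gball ζ (2*r) ∩ {η' | P ≤ f η' ∧ f η' ≤ Q})
        (fun η' => 2 * ‖g η'‖) η ∂(sphMeasure d) := by
  have := sphMeasure_finite hd
  have hw1 : 4 * r ≤ polarAngle ζ := by
    have := min_le_left (polarAngle ζ) (Real.pi - polarAngle ζ); unfold sphWidth at hrw; linarith
  have hw2 : 4 * r ≤ Real.pi - polarAngle ζ := by
    have := min_le_right (polarAngle ζ) (Real.pi - polarAngle ζ); unfold sphWidth at hrw; linarith
  obtain ⟨p, h, hc, hs⟩ := exists_frame ζ (by linarith) (by linarith)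
  set c := 3 * r / 2 with hcdef
  set G : Sph d → ℝ := Set.indicator (gball ζ (2*r) ∩ {η' | P ≤ f η' ∧ f η' ≤ Q})
        (fun η' => 2 * ‖g η'‖) with hG
  have hmeas : MeasurableSet (gball ζ (2*r) ∩ {η' | P ≤ f η' ∧ f η' ≤ Q}) := by
    refine (measurableSet_gball ζ _).inter ?_
    exact ((isClosed_le continuous_const hf).inter (isClosed_le hf continuous_const)).measurableSet
  have hGi : Integrable G (sphMeasure d) := (hfg.2.1.norm.const_mul 2).indicator hmeas
  have hG0 : ∀ η, 0 ≤ G η := fun η => Set.indicator_nonneg (fun _ _ => by positivity) _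
  have hprod := Trot_integrable_prod hd h hGi (volume.restrict (Set.Icc (-c) c))
  -- hitting polar angles
  have hpa : ∀ s, |s| ≤ c → polarAngle (Trot h s ζ) = polarAngle ζ + s := by
    intro s hsc
    rw [abs_le] at hsc
    have e1 : ⟪(npole d : Euc (d+1)), rotL (npole d : Euc (d+1)) p s ζ⟫
        = Real.cos (polarAngle ζ + s) := by
      rw [inner_e_rot h, hc, hs, Real.cos_add]; ring
    conv_lhs => unfold polarAngle geodist Trot
    simp only [e1]
    rw [Real.arccos_cos (by linarith [hsc.1]) (by linarith [hsc.2])]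
  have hclose : ∀ x y : Sph d, |polarAngle x - polarAngle y| ≤ geodist x y := by
    intro x y
    have t1 := geodist_tri (npole d) x y
    have t2 := geodist_tri (npole d) y x
    rw [geodist_comm y x] at t2
    unfold polarAngle
    rw [abs_le]; constructor <;> linarith
  have hhit : ∀ η ∈ gball ζ (r/2), ∀ η1 ∈ gball ζ r, ∃ s, |s| ≤ c ∧ f (Trot h s η) = f η1 := by
    intro η hη η1 h1
    have hη' : geodist ζ η < r / 2 := hη
    have h1' : geodist ζ η1 < r := h1
    have hcont : Continuous (fun s => polarAngle (Trot h s η)) :=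
      (continuous_geodist (npole d)).comp (continuous_Trot_left h η)
    have hcpos : 0 < c := by positivity
    have k : ∀ s, |s| ≤ c → |polarAngle ζ + s - polarAngle (Trot h s η)| < r / 2 := by
      intro s hsc
      rw [← hpa s hsc]
      exact (hclose _ _).trans_lt (by rw [geodist_Trot]; exact hη')
    have k1 := abs_lt.1 (k (-c) (by rw [abs_neg, abs_of_pos hcpos]))
    have k2 := abs_lt.1 (k c (by rw [abs_of_pos hcpos]))
    have k3 := abs_lt.1 ((hclose ζ η1).trans_lt h1')
    obtain ⟨s, hs1, hs2⟩ := intermediate_value_Icc (by linarith : -c ≤ c) hcont.continuousOn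
      (show polarAngle η1 ∈ Set.Icc _ _ from ⟨by linarith [k1.2, k3.2], by linarith [k2.2, k3.1]⟩)
    exact ⟨s, abs_le.2 hs1, polar_eq hpol hs2⟩
  have hae : ∀ᵐ η ∂(sphMeasure d), η ∈ gball ζ (r/2) → Q - P ≤ ∫ s in Set.Icc (-c) c, G (Trot h s η) := by
    filter_upwards [flow_ae hd hfg hf h, hprod.prod_left_ae] with η ha hb hη
    obtain ⟨x, hx, hfx⟩ := hhit η hη η1 h1
    obtain ⟨y, hy, hfy⟩ := hhit η hη η2 h2
    refine flow_lower hf h hPQ (gball ζ (2*r)) η ?_ ha.1 ha.2 hb hx hy (hfx ▸ hf1) (hfy ▸ hf2)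
    intro s hsc
    have t := geodist_tri ζ (Trot h s ζ) (Trot h s η)
    rw [geodist_Trot, geodist_Trot_self h (by linarith [Real.pi_pos]) ζ hc hs] at t
    have hη' : geodist ζ η < r / 2 := hη
    change geodist _ _ < _
    linarith
  have hJ : Integrable (fun η => ∫ s in Set.Icc (-c) c, G (Trot h s η)) (sphMeasure d) :=
    hprod.integral_prod_right
  have hJ0 : ∀ η, 0 ≤ ∫ s in Set.Icc (-c) c, G (Trot h s η) := fun η => integral_nonneg fun s => hG0 _
  calc (Q - P) * (sphMeasure d).real (gball ζ (r/2))
      = ∫ η in gball ζ (r/2), (Q - P) ∂(sphMeasure d) := by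
        rw [setIntegral_const, smul_eq_mul, mul_comm]
    _ ≤ ∫ η in gball ζ (r/2), (∫ s in Set.Icc (-c) c, G (Trot h s η)) ∂(sphMeasure d) :=
        setIntegral_mono_on_ae (integrable_const _) hJ.integrableOn (measurableSet_gball _ _) hae
    _ ≤ ∫ η, (∫ s in Set.Icc (-c) c, G (Trot h s η)) ∂(sphMeasure d) :=
        setIntegral_le_integral hJ (Eventually.of_forall hJ0)
    _ = ∫ s in Set.Icc (-c) c, (∫ η, G (Trot h s η) ∂(sphMeasure d)) :=
        (integral_integral_swap (f := fun s η => G (Trot h s η)) hprod).symm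
    _ = 3 * r * ∫ η, G η ∂(sphMeasure d) := by
        simp only [Trot_integral]
        rw [setIntegral_const, smul_eq_mul, Real.volume_real_Icc_of_le (by linarith)]
        congr 1; rw [hcdef]; ring

lemma gdir_norm_le {d : ℕ} (ξ ζ : Sph d) : ‖gdir ξ ζ‖ ≤ 1 := by
  unfold gdir
  rw [norm_smul, norm_inv, norm_norm]
  exact inv_mul_le_one

lemma arith_est {D V2 V X I K : ℝ} (hK : 0 ≤ K) (hV2 : 0 < V2) (hV : 0 < V) (hI : 0 ≤ I)
    (hX : X ≤ K * I / V) (hVV : V2 ≤ D * V) : X ≤ K * D * (V2⁻¹ * I) := by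
  refine hX.trans ?_
  rw [div_le_iff₀ hV]
  have : K * D * (V2⁻¹ * I) * V = K * I * (D * V / V2) := by field_simp
  rw [this]
  have h1 : 1 ≤ D * V / V2 := (one_le_div hV2).2 hVV
  nlinarith [mul_nonneg hK hI]

lemma final_est {d : ℕ} (hd : 1 ≤ d) {β : ℝ} (hβ0 : 0 < β) {M : ℝ} (hM : 0 < M)
    (hMst : ∀ x : ℝ, |deriv Real.smoothTransition x| ≤ M)
    {f : Sph d → ℝ} {g : Sph d → Euc (d + 1)} (hfg : MemW11 f g) (hpol : IsPolar f)
    (hf0 : ∀ ξ, 0 ≤ f ξ) (hf : Continuous f) {ξ ζ : Sph d} {r : ℝ} (hb : IsBestBall β f ξ ζ r)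
    (hrw : r ≤ sphWidth ζ / 4) (hr : 0 < r) {A : ℝ}
    (hA : A = ⨍ η in gball ζ r, f η ∂(sphMeasure d)) :
    |⨍ η in gball ζ r, ⟪g η, Svec ξ η⟫ ∂(sphMeasure d)| ≤
      (2 * (1 + C0 d) + 192 * M * C0 d * (1 + C0 d) * (1 + C0 d)) *
        ⨍ η in gball ζ (2 * r), Set.indicator {η' : Sph d | (1 / 2) * A ≤ f η' ∧ f η' ≤ 2 * A}
              (fun η' => ‖g η'‖) η ∂(sphMeasure d) := by
  have := sphMeasure_finite hd
  have hC0 := C0_pos hd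
  have hr8 : r ≤ Real.pi / 8 := by
    have h1 := min_le_left (polarAngle ζ) (Real.pi - polarAngle ζ)
    have h2 := min_le_right (polarAngle ζ) (Real.pi - polarAngle ζ)
    unfold sphWidth at hrw; linarith
  have hup := upper_est hd hM hMst hfg hf hf0 (u := ξ) (v := gdir ξ (npole d)) (sph_norm ξ).le
    (gdir_norm_le _ _) ζ hr hr8 (fun s hs1 hs2 => best_avg hd hβ0 hf hf0 hr hb hs1
      (by linarith [Real.pi_pos]))
  rw [← hA] at hup
  set E : Set (Sph d) := {η' : Sph d | (1 / 2) * A ≤ f η' ∧ f η' ≤ 2 * A} with hE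
  have hEm : MeasurableSet E :=
    ((isClosed_le continuous_const hf).inter (isClosed_le hf continuous_const)).measurableSet
  have hgn : Integrable (fun η => ‖g η‖) (sphMeasure d) := hfg.2.1.norm
  have hEi : Integrable (E.indicator (fun η' => ‖g η'‖)) (sphMeasure d) := hgn.indicator hEm
  have hE0 : ∀ η, 0 ≤ E.indicator (fun η' => ‖g η'‖) η :=
    fun η => Set.indicator_nonneg (fun _ _ => norm_nonneg _) _
  set I := ∫ η in gball ζ (2 * r), E.indicator (fun η' => ‖g η'‖) η ∂(sphMeasure d) with hI
  have hI0 : 0 ≤ I := integral_nonneg hE0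
  set V := (sphMeasure d).real (gball ζ r) with hV
  set V2 := (sphMeasure d).real (gball ζ (2 * r)) with hV2
  set Vh := (sphMeasure d).real (gball ζ (r / 2)) with hVh
  have hVp : 0 < V := gball_pos hd ζ hr
  have hV2p : 0 < V2 := gball_pos hd ζ (by linarith)
  have hVhp : 0 < Vh := gball_pos hd ζ (by linarith)
  have hD1 : V2 ≤ (1 + C0 d) * V := doubling hd ζ hr hr8
  have hD2 : V ≤ (1 + C0 d) * Vh := by
    have := doubling hd ζ (r := r / 2) (by linarith) (by linarith)
    rwa [mul_div_cancel₀ _ (two_ne_zero)] at this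
  have hVh2 : V2 ≤ ((1 + C0 d) * (1 + C0 d)) * Vh := by nlinarith
  have eL : |⨍ η in gball ζ r, ⟪g η, Svec ξ η⟫ ∂(sphMeasure d)| =
      |∫ η in gball ζ r, ⟪g η, Svec ξ η⟫ ∂(sphMeasure d)| / V := by
    rw [setAverage_eq, smul_eq_mul, abs_mul, abs_inv, abs_of_pos hVp]
    ring
  have eR : ⨍ η in gball ζ (2 * r), E.indicator (fun η' => ‖g η'‖) η ∂(sphMeasure d) = V2⁻¹ * I := by
    rw [setAverage_eq, smul_eq_mul]
  rw [eR, eL]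
  have hZ : 0 ≤ V2⁻¹ * I := by positivity
  by_cases hcase : ∀ η ∈ gball ζ r, η ∈ E
  · have b1 : |∫ η in gball ζ r, ⟪g η, Svec ξ η⟫ ∂(sphMeasure d)| ≤ 2 * I := by
      calc |∫ η in gball ζ r, ⟪g η, Svec ξ η⟫ ∂(sphMeasure d)|
          ≤ ∫ η in gball ζ r, |⟪g η, Svec ξ η⟫| ∂(sphMeasure d) := abs_integral_le_integral_abs
        _ ≤ ∫ η in gball ζ r, 2 * E.indicator (fun η' => ‖g η'‖) η ∂(sphMeasure d) := by
          refine setIntegral_mono_on ?_ (hEi.const_mul 2).integrableOn (measurableSet_gball _ _) ?_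
          · exact (gS_integrable hd hfg.2.1 ξ (gdir ξ (npole d))).abs.integrableOn
          · intro η hη
            rw [Set.indicator_of_mem (hcase η hη)]
            refine (abs_real_inner_le_norm _ _).trans ?_
            have := Sk_norm_le (sph_norm ξ).le (gdir_norm_le ξ (npole d)) (η : Euc (d+1))
            rw [sph_norm, ← Svec_eq] at this
            nlinarith [norm_nonneg (g η)]
        _ = 2 * ∫ η in gball ζ r, E.indicator (fun η' => ‖g η'‖) η ∂(sphMeasure d) :=
          integral_const_mul _ _
        _ ≤ 2 * I := by
          gcongr
          refine setIntegral_mono_set hEi.integrableOn (Eventually.of_forall hE0) ?_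
          exact (gball_mono ζ (by linarith)).eventuallyLE
    have := arith_est (K := 2) (by norm_num) hV2p hVp hI0 (div_le_div_of_nonneg_right b1 hVp.le) hD1
    refine this.trans ?_
    gcongr
    have : 0 < 192 * M * C0 d * (1 + C0 d) * (1 + C0 d) := by positivity
    linarith
  have hLA : |∫ η in gball ζ r, ⟪g η, Svec ξ η⟫ ∂(sphMeasure d)| / V ≤ 16 * M * C0 d * A / r := by
    rw [div_le_iff₀ hVp]
    refine hup.trans (le_of_eq ?_)
    ring
  have hA0 : 0 ≤ A := by
    rw [hA, setAverage_eq, smul_eq_mul]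
    exact mul_nonneg (by positivity) (integral_nonneg hf0)
  rcases hA0.eq_or_lt with hAz | hApos
  · rw [← hAz] at hLA
    have : (16 * M * C0 d * 0 / r) = 0 := by simp
    rw [this] at hLA
    refine hLA.trans (mul_nonneg (by positivity) hZ)
  have hfi := cont_integrable hd hf
  have hμ0 : (sphMeasure d) (gball ζ r) ≠ 0 := by
    intro h0
    have : V = 0 := by rw [hV, measureReal_def, h0]; simp
    linarith
  obtain ⟨η1, hη1, hfη1⟩ := exists_le_setAverage hμ0 (measure_ne_top _ _) hfi.integrableOn
  obtain ⟨η2, hη2, hfη2⟩ := exists_setAverage_le hμ0 (measure_ne_top _ _) hfi.integrableOn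
  rw [← hA] at hfη1 hfη2
  have key : ∀ P Q : ℝ, A / 2 ≤ Q - P → (1/2) * A ≤ P → Q ≤ 2 * A →
      (∃ x ∈ gball ζ r, f x ≤ P) → (∃ y ∈ gball ζ r, Q ≤ f y) → A * Vh ≤ 12 * r * I := by
    rintro P Q hPQ hP hQ ⟨x, hx, hfx⟩ ⟨y, hy, hfy⟩
    have := lower_est hd hfg hf hpol ζ hr hrw (P := P) (Q := Q) (by linarith) hx hy hfx hfy
    have b2 : ∫ η, Set.indicator (gball ζ (2*r) ∩ {η' | P ≤ f η' ∧ f η' ≤ Q})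
        (fun η' => 2 * ‖g η'‖) η ∂(sphMeasure d) ≤ 2 * I := by
      rw [hI, ← integral_const_mul, ← integral_indicator (measurableSet_gball _ _)]
      refine integral_mono ?_ ?_ ?_
      · refine (hgn.const_mul 2).indicator ((measurableSet_gball ζ _).inter ?_)
        exact ((isClosed_le continuous_const hf).inter (isClosed_le hf continuous_const)).measurableSet
      · exact (hEi.const_mul 2).indicator (measurableSet_gball _ _)
      · intro η
        by_cases hη : η ∈ gball ζ (2*r) ∩ {η' | P ≤ f η' ∧ f η' ≤ Q}
        · have hηE : η ∈ E := ⟨hP.trans hη.2.1, hη.2.2.trans hQ⟩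
          simp only [Set.indicator_of_mem hη, Set.indicator_of_mem hη.1, Set.indicator_of_mem hηE]
          exact le_refl _
        · simp only [Set.indicator_of_notMem hη]
          exact Set.indicator_nonneg (fun z _ => mul_nonneg zero_le_two (hE0 z)) _
    have b3 : A / 2 * Vh ≤ 3 * r * (2 * I) :=
      (mul_le_mul_of_nonneg_right hPQ hVhp.le).trans (this.trans (by gcongr))
    linarith
  have hAV : A * Vh ≤ 12 * r * I := by
    push Not at hcase
    obtain ⟨η3, hη3, hη3E⟩ := hcase
    by_cases h3 : (1/2) * A ≤ f η3
    · have h4 : 2 * A ≤ f η3 := by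
        by_contra hc
        exact hη3E ⟨h3, (not_le.1 hc).le⟩
      exact key A (2 * A) (by linarith) (by linarith) le_rfl ⟨η1, hη1, hfη1⟩ ⟨η3, hη3, h4⟩
    · exact key ((1/2) * A) A (by linarith) le_rfl (by linarith) ⟨η3, hη3, (not_le.1 h3).le⟩
        ⟨η2, hη2, hfη2⟩
  have hX : 16 * M * C0 d * A / r ≤ (192 * M * C0 d) * I / Vh := by
    rw [div_le_div_iff₀ hr hVhp]
    have : 0 < 16 * M * C0 d := by positivity
    nlinarith
  have := arith_est (K := 192 * M * C0 d) (by positivity) hV2p hVhp hI0 (hLA.trans hX) hVh2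
  refine this.trans ?_
  gcongr
  have : 0 < 2 * (1 + C0 d) := by positivity
  linarith

/-- **Estimate for small radii.** For nonnegative Lipschitz `f ∈ W^{1,1}_pol(𝕊^d)`,
a best ball `𝓑 = B̄(ζ,r) ∈ 𝐁_ξ^β` with `r ≤ w(ζ)/4`, and
`𝓔 = {η ∈ 2𝓑 : (1/2)⨍_𝓑 f ≤ f(η) ≤ 2⨍_𝓑 f}`:
`|⨍_𝓑 ∇f(η)·S(η) dσ(η)| ≤ C(d,β) ⨍_{2𝓑} |∇f(η)| χ_𝓔(η) dσ(η)`. -/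
theorem small_radii_estimate (d : ℕ) (hd : 1 ≤ d) (β : ℝ) (hβ0 : 0 < β) (hβd : β < d) :
    ∃ C : ℝ, 0 < C ∧ ∀ (f : Sph d → ℝ) (g : Sph d → Euc (d + 1)),
      MemW11 f g → IsPolar f → (∀ ξ, 0 ≤ f ξ) → (∃ K : NNReal, LipschitzWith K f) →
      ∀ (ξ ζ : Sph d) (r : ℝ),
        IsBestBall β f ξ ζ r → r ≤ sphWidth ζ / 4 →
        |⨍ η in gball ζ r, ⟪g η, Svec ξ η⟫ ∂(sphMeasure d)| ≤
          C * ⨍ η in gball ζ (2 * r),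
            Set.indicator {η' : Sph d |
                (1 / 2) * (⨍ η'' in gball ζ r, f η'' ∂(sphMeasure d)) ≤ f η' ∧
                f η' ≤ 2 * (⨍ η'' in gball ζ r, f η'' ∂(sphMeasure d))}
              (fun η' => ‖g η'‖) η ∂(sphMeasure d) := by
  obtain ⟨M, hM, hMst⟩ := exists_st_bound
  have hC0 := C0_pos hd
  refine ⟨2 * (1 + C0 d) + 192 * M * C0 d * (1 + C0 d) * (1 + C0 d), by positivity, ?_⟩
  rintro f g hfg hpol hf0 ⟨K, hK⟩ ξ ζ r hb hrw
  rcases hb.1.eq_or_lt with h0 | hr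
  · rw [gball_zero ζ (le_of_eq h0.symm), gball_zero ζ (by linarith : 2 * r ≤ 0)]
    simp
  · exact final_est hd hβ0 hM hMst hfg hpol hf0 hK.continuous hb hrw hr rfl

end
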